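/- Let V be a nonzero Banach 𝕆-bimodule and T a power-associative bounded right para-linear operator on V. Then every s ∈ 𝕆 with |s| > ‖T‖ lies in the pull-back resolvent set ρ*(T), and for every J ∈ 𝕊 the slice pull-back spectrum σ*_J(T) := ℂ_J ∖ ρ*_J(T) is a nonempty compact subset of ℂ_J contained in the closed disk of radius ‖T‖. -/

import Mathlib

noncomputable section

open scoped BigOperators

/-- Octonions, realized via the Cayley–Dickson doubling of the quaternions. -/
@[ext]
structure Oct : Type where
  a : Quaternion ℝ
  b : Quaternion ℝ

namespace Oct

instance : Zero Oct := ⟨⟨0, 0⟩⟩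
instance : Add Oct := ⟨fun x y => ⟨x.a + y.a, x.b + y.b⟩⟩
instance : Neg Oct := ⟨fun x => ⟨-x.a, -x.b⟩⟩
instance : Sub Oct := ⟨fun x y => ⟨x.a - y.a, x.b - y.b⟩⟩
instance : SMul ℕ Oct := ⟨fun n x => ⟨n • x.a, n • x.b⟩⟩
instance : SMul ℤ Oct := ⟨fun n x => ⟨n • x.a, n • x.b⟩⟩
instance : SMul ℝ Oct := ⟨fun r x => ⟨r • x.a, r • x.b⟩⟩

def toLp (x : Oct) : WithLp 2 (Quaternion ℝ × Quaternion ℝ) :=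
  (WithLp.equiv 2 (Quaternion ℝ × Quaternion ℝ)).symm (x.a, x.b)

lemma toLp_injective : Function.Injective toLp := by
  rintro ⟨xa, xb⟩ ⟨ya, yb⟩ h
  have ha : xa = ya :=
    congrArg (fun z => (WithLp.equiv 2 (Quaternion ℝ × Quaternion ℝ) z).1) h
  have hb : xb = yb :=
    congrArg (fun z => (WithLp.equiv 2 (Quaternion ℝ × Quaternion ℝ) z).2) h
  subst ha; subst hb; rfl

instance : AddCommGroup Oct :=
  toLp_injective.addCommGroup toLp rfl (fun _ _ => rfl) (fun _ => rfl) (fun _ _ => rfl)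
    (fun _ _ => rfl) (fun _ _ => rfl)

def toLpHom : Oct →+ WithLp 2 (Quaternion ℝ × Quaternion ℝ) where
  toFun := toLp
  map_zero' := rfl
  map_add' _ _ := rfl

instance : Module ℝ Oct := toLp_injective.module ℝ toLpHom fun _ _ => rfl

instance : NormedAddCommGroup Oct :=
  NormedAddCommGroup.induced Oct (WithLp 2 (Quaternion ℝ × Quaternion ℝ)) toLpHom toLp_injective

instance : NormedSpace ℝ Oct := ⟨fun r x => norm_smul_le r (toLp x)⟩

def toProdLin : Oct →ₗ[ℝ] Quaternion ℝ × Quaternion ℝ where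
  toFun x := (x.a, x.b)
  map_add' _ _ := rfl
  map_smul' _ _ := rfl

lemma toProdLin_injective : Function.Injective toProdLin := by
  rintro ⟨xa, xb⟩ ⟨ya, yb⟩ h
  have ha : xa = ya := congrArg Prod.fst h
  have hb : xb = yb := congrArg Prod.snd h
  subst ha; subst hb; rfl

instance : FiniteDimensional ℝ Oct :=
  FiniteDimensional.of_injective toProdLin toProdLin_injective

instance : CompleteSpace Oct := FiniteDimensional.complete ℝ Oct

instance : One Oct := ⟨⟨1, 0⟩⟩

instance : Mul Oct :=
  ⟨fun x y => ⟨x.a * y.a - star y.b * x.b, y.b * x.a + x.b * star y.a⟩⟩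

/-- Octonionic conjugation. -/
def conj (x : Oct) : Oct := ⟨star x.a, -x.b⟩

/-- The real part of an octonion. -/
def re (x : Oct) : ℝ := x.a.re

/-- Powers of an octonion (association chosen on the left factor). -/
def opow (s : Oct) : ℕ → Oct
  | 0 => 1
  | n + 1 => s * opow s n

/-- The inverse of a nonzero octonion. -/
def oinv (s : Oct) : Oct := (‖s‖ ^ 2)⁻¹ • conj s

/-- `invPow s n` is the octonion `s ^ (-1 - n)`. -/
def invPow (s : Oct) (n : ℕ) : Oct := opow (oinv s) (n + 1)

def eNat : ℕ → Oct
  | 0 => ⟨1, 0⟩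
  | 1 => ⟨⟨0, 1, 0, 0⟩, 0⟩
  | 2 => ⟨⟨0, 0, 1, 0⟩, 0⟩
  | 3 => ⟨⟨0, 0, 0, 1⟩, 0⟩
  | 4 => ⟨0, 1⟩
  | 5 => ⟨0, ⟨0, 1, 0, 0⟩⟩
  | 6 => ⟨0, ⟨0, 0, 1, 0⟩⟩
  | 7 => ⟨0, ⟨0, 0, 0, 1⟩⟩
  | _ => 0

/-- The standard basis `e_0 = 1, e_1, …, e_7` of the octonions. -/
def e (i : Fin 8) : Oct := eNat i.val

/-- The six-dimensional sphere `𝕊` of imaginary units of `𝕆`. -/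
def unitSphere : Set Oct := {J | J * J = -1}

/-- The slice `ℂ_J = ℝ ⊕ ℝJ` of the octonions. -/
def sliceC (J : Oct) : Set Oct := {s | ∃ x y : ℝ, s = x • (1 : Oct) + y • J}

/-- The embedding of `ℂ` onto the slice `ℂ_J`, `x + y i ↦ x + y J`. -/
def toSlice (J : Oct) (z : ℂ) : Oct := z.re • (1 : Oct) + z.im • J

end Oct

open Oct

/-- A (normed/Banach) `𝕆`-bimodule: a real normed space with continuous real-bilinear left and
right octonionic multiplications satisfying the alternativity relations
`[p,q,x] = [q,x,p] = [x,p,q] = -[q,p,x]` and the norm identities `‖px‖ = |p|‖x‖ = ‖xp‖`. -/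
class OctBimodule (V : Type*) [NormedAddCommGroup V] [NormedSpace ℝ V] : Type _ where
  lm : Oct →ₗ[ℝ] V →L[ℝ] V
  rm : Oct →ₗ[ℝ] V →L[ℝ] V
  lm_one : ∀ x : V, lm 1 x = x
  rm_one : ∀ x : V, rm 1 x = x
  /-- `[p,q,x] = [q,x,p]` -/
  assoc_cyc₁ : ∀ (p q : Oct) (x : V),
    lm (p * q) x - lm p (lm q x) = rm p (lm q x) - lm q (rm p x)
  /-- `[p,q,x] = [x,p,q]` -/
  assoc_cyc₂ : ∀ (p q : Oct) (x : V),
    lm (p * q) x - lm p (lm q x) = rm q (rm p x) - rm (p * q) x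
  /-- `[p,q,x] = -[q,p,x]` -/
  assoc_alt : ∀ (p q : Oct) (x : V),
    lm (p * q) x - lm p (lm q x) = -(lm (q * p) x - lm q (lm p x))
  norm_lm : ∀ (p : Oct) (x : V), ‖lm p x‖ = ‖p‖ * ‖x‖
  norm_rm : ∀ (p : Oct) (x : V), ‖rm p x‖ = ‖p‖ * ‖x‖

section OctMod

variable {V : Type*} [NormedAddCommGroup V] [NormedSpace ℝ V] [OctBimodule V]

/-- Left multiplication `x ↦ p x` as a bounded real-linear operator. -/
def lmo (p : Oct) : V →L[ℝ] V := OctBimodule.lm p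

/-- Right multiplication `R_p : x ↦ x p` as a bounded real-linear operator. -/
def rmo (p : Oct) : V →L[ℝ] V := OctBimodule.rm p

variable (V)

/-- The real-part projection `Re x = (5/12) x - (1/12) ∑_{i=1}^7 e_i x e_i` of an
`𝕆`-bimodule. -/
def reO : V →L[ℝ] V :=
  (5 / 12 : ℝ) • ContinuousLinearMap.id ℝ V -
    (1 / 12 : ℝ) • ∑ i : Fin 7, (rmo (e i.succ)).comp (lmo (e i.succ))

/-- The real part `Re V` of an `𝕆`-bimodule, i.e. the set of associative central elements. -/
def ReSet : Set V :=
  {m | (∀ p q : Oct, lmo (p * q) m = lmo p (lmo q m)) ∧ ∀ p : Oct, lmo p m = rmo p m}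

/-- The slice `ℂ_J(V) = Re V ⊕ J · Re V` of an `𝕆`-bimodule. -/
def CJV (J : Oct) : Set V :=
  {x | ∃ u ∈ ReSet V, ∃ w ∈ ReSet V, x = u + lmo J w}

/-- The slice projection `π_J(x) = Re x + J Re (J̄ x)`. -/
def piJ (J : Oct) : V →L[ℝ] V :=
  reO V + (lmo J).comp ((reO V).comp (lmo (Oct.conj J)))

variable {V}

/-- The second right associator `B_p(T, x) = T(x) p - T(x p)` of an operator. -/
def Bop (p : Oct) (T : V →L[ℝ] V) : V →L[ℝ] V := (rmo p).comp T - T.comp (rmo p)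

/-- A bounded real-linear operator is right (octonionic) para-linear if `Re B_p(T,x) = 0`. -/
def IsRightPara (T : V →L[ℝ] V) : Prop := ∀ (p : Oct) (x : V), reO V (Bop p T x) = 0

/-- The left octonionic scalar multiplication `(p ⊙ T)(x) = p T(x) + B_p(T,x)` on operators. -/
def odotL (p : Oct) (T : V →L[ℝ] V) : V →L[ℝ] V := (lmo p).comp T + Bop p T

/-- The right octonionic scalar multiplication `(T ⊙ p)(x) = T(p x) - B_p(T,x)` on operators. -/
def odotR (T : V →L[ℝ] V) (p : Oct) : V →L[ℝ] V := T.comp (lmo p) - Bop p T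

/-- The lifting map, `(lif F)(x) = ∑_i F(x ē_i) e_i`. -/
def lifO (F : V →L[ℝ] V) : V →L[ℝ] V :=
  ∑ i : Fin 8, (rmo (e i)).comp (F.comp (rmo (Oct.conj (e i))))

/-- The extension map, `(ext G)(∑ x_i e_i) = ∑ G(x_i) e_i`, where `x_i = Re (x ē_i)`. -/
def extO (G : V →L[ℝ] V) : V →L[ℝ] V :=
  ∑ i : Fin 8, (rmo (e i)).comp (G.comp ((reO V).comp (rmo (Oct.conj (e i)))))

/-- The left regular power `T^{n⊚} = lif (Re ∘ Tⁿ)`. -/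
def rpowL (T : V →L[ℝ] V) (n : ℕ) : V →L[ℝ] V := lifO ((reO V).comp (T ^ n))

/-- The right regular power `T^{⊚n} = ext (Tⁿ|_{Re V})`. -/
def rpowR (T : V →L[ℝ] V) (n : ℕ) : V →L[ℝ] V := extO (T ^ n)

/-- The regular composition `f ⊚ g = lif (Re ∘ f ∘ g)`. -/
def rcomp (f g : V →L[ℝ] V) : V →L[ℝ] V := lifO ((reO V).comp (f.comp g))

/-- The composition associator `[f,g,x]_⊚ = (f ⊚ g)(x) - f(g(x))`. -/
def compAssoc (f g : V →L[ℝ] V) (x : V) : V := rcomp f g x - f (g x)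

/-- The right regular inverse `T^{⊚-} = ext (T⁻¹|_{Re V})` of an invertible operator. -/
def rinvR (T : V →L[ℝ] V) : V →L[ℝ] V := extO (Ring.inverse T)

/-- The left regular inverse `T^{-⊚} = lif (Re ∘ T⁻¹)` of an invertible operator. -/
def rinvL (T : V →L[ℝ] V) : V →L[ℝ] V := lifO ((reO V).comp (Ring.inverse T))

/-- An operator is power-associative if all of its (composition) powers are right
para-linear. -/
def IsPowerAssoc (T : V →L[ℝ] V) : Prop := ∀ n : ℕ, IsRightPara (T ^ n)

/-- A bounded operator is octonionic linear if `T(xp) = T(x)p` for all `p`. -/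
def IsOctLinear (T : V →L[ℝ] V) : Prop := ∀ (p : Oct) (x : V), T (rmo p x) = rmo p (T x)

/-- `S` is `ℂ_J`-extendable power associative: `Sⁿ(v s) = Sⁿ(v) s` for `v ∈ Re V`,
`s ∈ ℂ_J`, `n ≥ 1`. -/
def CJExtPA (J : Oct) (S : V →L[ℝ] V) : Prop :=
  ∀ n : ℕ, 1 ≤ n → ∀ v ∈ ReSet V, ∀ s ∈ sliceC J, (S ^ n) (rmo s v) = rmo s ((S ^ n) v)

/-- `S` is `ℂ_J`-liftable power associative: `Re (Sⁿ(v s)) = Re (Sⁿ(v) s)` for all `v ∈ V`,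
`s ∈ ℂ_J`, `n ≥ 1`. -/
def CJLiftPA (J : Oct) (S : V →L[ℝ] V) : Prop :=
  ∀ n : ℕ, 1 ≤ n → ∀ (v : V), ∀ s ∈ sliceC J,
    reO V ((S ^ n) (rmo s v)) = reO V (rmo s ((S ^ n) v))

/-- The pull-back slice-resolvent set `ρ*_J(T)`. -/
def pbResSlice (T : V →L[ℝ] V) (J : Oct) : Set Oct :=
  {s | s ∈ sliceC J ∧ IsUnit ((rmo s : V →L[ℝ] V) - T) ∧
    CJExtPA J (Ring.inverse ((rmo s : V →L[ℝ] V) - T))}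

/-- The pull-back resolvent set `ρ*(T)`. -/
def pbRes (T : V →L[ℝ] V) : Set Oct := ⋃ J ∈ unitSphere, pbResSlice T J

/-- The pull-back spectrum `σ*(T) = 𝕆 ∖ ρ*(T)`. -/
def pbSpec (T : V →L[ℝ] V) : Set Oct := Set.univ \ pbRes T

/-- The push-forward slice-resolvent set `ρ_{*J}(T)`. -/
def pfResSlice (T : V →L[ℝ] V) (J : Oct) : Set Oct :=
  {s | s ∈ sliceC J ∧ IsUnit ((rmo s : V →L[ℝ] V) - T) ∧
    CJLiftPA J (Ring.inverse ((rmo s : V →L[ℝ] V) - T))}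

/-- The push-forward resolvent set `ρ_*(T)`. -/
def pfRes (T : V →L[ℝ] V) : Set Oct := ⋃ J ∈ unitSphere, pfResSlice T J

/-- The push-forward spectrum `σ_*(T) = 𝕆 ∖ ρ_*(T)`. -/
def pfSpec (T : V →L[ℝ] V) : Set Oct := Set.univ \ pfRes T

/-- The real-part projection of the `𝕆`-bimodule `𝓑_RO(V)` of bounded right para-linear
operators, given by `Re A = (5/12) A - (1/12) ∑_{i=1}^7 (e_i ⊙ A) ⊙ e_i`. -/
def reOpB (A : V →L[ℝ] V) : V →L[ℝ] V :=
  (5 / 12 : ℝ) • A - (1 / 12 : ℝ) • ∑ i : Fin 7, odotR (odotL (e i.succ) A) (e i.succ)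

end OctMod

/-- A set `U ⊆ 𝕆` is slice-open if `U ∩ ℂ_J` is open in `ℂ_J` for every `J ∈ 𝕊`. -/
def SliceOpen (U : Set Oct) : Prop :=
  ∀ J ∈ unitSphere, IsOpen (Oct.toSlice J ⁻¹' U)

/-- A parametrization of the boundary `∂(U ∩ ℂ_J)` by finitely many continuously
differentiable, positively oriented Jordan curves (positivity of the orientation is encoded
through the winding numbers). -/
structure SliceContour (J : Oct) (U : Set Oct) where
  n : ℕ
  γ : Fin n → ℝ → ℂ
  smooth : ∀ i, ContDiff ℝ 1 (γ i)
  closed : ∀ i, γ i 0 = γ i 1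
  jordan : ∀ i, Set.InjOn (γ i) (Set.Ico (0 : ℝ) 1)
  image_eq : (⋃ i, γ i '' Set.Icc (0 : ℝ) 1) = frontier (Oct.toSlice J ⁻¹' U)
  winding_inside : ∀ z : ℂ, Oct.toSlice J z ∈ U →
    (∑ i, ∫ t in (0 : ℝ)..1, deriv (γ i) t / (γ i t - z)) = 2 * (Real.pi : ℂ) * Complex.I
  winding_outside : ∀ z : ℂ, Oct.toSlice J z ∉ closure U →
    (∑ i, ∫ t in (0 : ℝ)..1, deriv (γ i) t / (γ i t - z)) = 0

/-- The integral `∫_{∂(U ∩ ℂ_J)} Φ(s, ds)` along a slice contour: the integrand gets the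
point of the curve and its derivative (both in the coordinates of the slice). -/
def contourSum {J : Oct} {U : Set Oct} (Γ : SliceContour J U) {E : Type*}
    [NormedAddCommGroup E] [NormedSpace ℝ E] (Φ : ℂ → ℂ → E) : E :=
  ∑ i, ∫ t in (0 : ℝ)..1, Φ (Γ.γ i t) (deriv (Γ.γ i) t)

/-- An axially symmetric slice domain (s-domain) in `𝕆`. -/
structure IsAdmissibleDomain (U : Set Oct) : Prop where
  isOpen : IsOpen U
  isConnected : IsConnected U
  real_nonempty : (U ∩ {s : Oct | ∃ r : ℝ, s = r • (1 : Oct)}).Nonempty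
  axially : ∀ (z : ℂ), ∀ I ∈ unitSphere, ∀ J ∈ unitSphere,
    Oct.toSlice I z ∈ U → Oct.toSlice J z ∈ U
  slice_conn : ∀ J ∈ unitSphere, IsConnected (Oct.toSlice J ⁻¹' U)

section Adm

variable {V : Type*} [NormedAddCommGroup V] [NormedSpace ℝ V] [OctBimodule V]

/-- A `T`-left-admissible domain: an axially symmetric s-domain containing the pull-back
spectrum `σ*(T)`.  (The regularity of its slice boundaries is witnessed by the slice
contours used in the integrals.) -/
def LeftAdmissible (T : V →L[ℝ] V) (U : Set Oct) : Prop :=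
  IsAdmissibleDomain U ∧ pbSpec T ⊆ U

/-- A `T`-right-admissible domain: an axially symmetric s-domain containing the push-forward
spectrum `σ_*(T)`. -/
def RightAdmissible (T : V →L[ℝ] V) (U : Set Oct) : Prop :=
  IsAdmissibleDomain U ∧ pfSpec T ⊆ U

end Adm

/-- The axially symmetric set `Ω_D ⊆ 𝕆` induced by a conjugation-invariant set `D ⊆ ℂ`. -/
def OmegaD (D : Set ℂ) : Set Oct := ⋃ J ∈ unitSphere, Oct.toSlice J '' D

/-- `F` is the stem of a slice preserving slice regular function on `Ω_D`: it is holomorphic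
on the open conjugation-invariant set `D` and intertwines complex conjugation. -/
structure IsStem (D : Set ℂ) (F : ℂ → ℂ) : Prop where
  isOpen : IsOpen D
  conj_mem : ∀ z ∈ D, (starRingEnd ℂ) z ∈ D
  holo : DifferentiableOn ℂ F D
  conj_comm : ∀ z ∈ D, F ((starRingEnd ℂ) z) = (starRingEnd ℂ) (F z)

section FC

variable {V : Type*} [NormedAddCommGroup V] [NormedSpace ℝ V] [OctBimodule V]

/-- The slice integral `(1/2π) ∫_{∂(U∩ℂ_J)} (R_s - T)^{⊚-} ⊙ (ds_J f(s))` defining the left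
slice regular functional calculus of a slice preserving function with stem `F`. -/
def leftFC (T : V →L[ℝ] V) (J : Oct) {U : Set Oct} (Γ : SliceContour J U)
    (F : ℂ → ℂ) : V →L[ℝ] V :=
  (2 * Real.pi)⁻¹ • contourSum Γ fun z dz =>
    odotR (rinvR ((rmo (Oct.toSlice J z) : V →L[ℝ] V) - T))
      ((-(Oct.toSlice J dz) * J) * Oct.toSlice J (F z))

/-- The slice integral `(1/2π) ∫_{∂(U∩ℂ_J)} (f(s) ds_J) ⊙ (R_s - T)^{-⊚}` defining the right
slice regular functional calculus of a slice preserving function with stem `F`. -/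
def rightFC (T : V →L[ℝ] V) (J : Oct) {U : Set Oct} (Γ : SliceContour J U)
    (F : ℂ → ℂ) : V →L[ℝ] V :=
  (2 * Real.pi)⁻¹ • contourSum Γ fun z dz =>
    odotL (Oct.toSlice J (F z) * (-(Oct.toSlice J dz) * J))
      (rinvL ((rmo (Oct.toSlice J z) : V →L[ℝ] V) - T))

end FC

/-- The family of stems of the components, relative to `J = ∑ c_i e_i`, of a function of the
form `f₀ + f₁ • J` with `f₀, f₁` slice preserving with stems `F₀, F₁`. -/
def stemFamily (c : Fin 8 → ℝ) (F₀ F₁ : ℂ → ℂ) : Fin 8 → ℂ → ℂ :=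
  fun i z => if i = 0 then F₀ z else (c i : ℂ) * F₁ z

namespace Oct

/-- Left multiplication by an octonion, as a real-linear map. -/
def lmulLin (q : Oct) : Oct →ₗ[ℝ] Oct where
  toFun x := q * x
  map_add' x y := by
    refine Oct.ext ?_ ?_
    · show q.a * (x.a + y.a) - star (x.b + y.b) * q.b =
        (q.a * x.a - star x.b * q.b) + (q.a * y.a - star y.b * q.b)
      rw [mul_add, star_add, add_mul]; abel
    · show (x.b + y.b) * q.a + q.b * star (x.a + y.a) =
        (x.b * q.a + q.b * star x.a) + (y.b * q.a + q.b * star y.a)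
      rw [add_mul, star_add, mul_add]; abel
  map_smul' r x := by
    refine Oct.ext ?_ ?_
    · show q.a * (r • x.a) - star (r • x.b) * q.b = r • (q.a * x.a - star x.b * q.b)
      rw [mul_smul_comm, Quaternion.star_smul, smul_mul_assoc, smul_sub]
    · show (r • x.b) * q.a + q.b * star (r • x.a) = r • (x.b * q.a + q.b * star x.a)
      rw [smul_mul_assoc, Quaternion.star_smul, mul_smul_comm, smul_add]

/-- Left multiplication `L_q : x ↦ q x` as a bounded real-linear operator on `𝕆`. -/
def Lq (q : Oct) : Oct →L[ℝ] Oct := (lmulLin q).toContinuousLinearMap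

/-- The two-sphere `[q] = {Re q + |Im q| J : J ∈ 𝕊}` associated with an octonion `q`. -/
def qSphere (q : Oct) : Set Oct :=
  {s | ∃ J ∈ unitSphere, s = Oct.re q • (1 : Oct) + ‖q - Oct.re q • (1 : Oct)‖ • J}

end Oct

namespace Oct

lemma add_a (x y : Oct) : (x + y).a = x.a + y.a := rfl
lemma add_b (x y : Oct) : (x + y).b = x.b + y.b := rfl
lemma sub_a (x y : Oct) : (x - y).a = x.a - y.a := rfl
lemma sub_b (x y : Oct) : (x - y).b = x.b - y.b := rfl
lemma neg_a (x : Oct) : (-x).a = -x.a := rfl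
lemma neg_b (x : Oct) : (-x).b = -x.b := rfl
lemma smul_a (r : ℝ) (x : Oct) : (r • x).a = r • x.a := rfl
lemma smul_b (r : ℝ) (x : Oct) : (r • x).b = r • x.b := rfl
lemma one_a : (1 : Oct).a = 1 := rfl
lemma one_b : (1 : Oct).b = 0 := rfl
lemma mul_a (x y : Oct) : (x * y).a = x.a * y.a - star y.b * x.b := rfl
lemma mul_b (x y : Oct) : (x * y).b = y.b * x.a + x.b * star y.a := rfl

/-- Equality of octonions can be checked on the eight real coordinates. -/
lemma ext_coords {x y : Oct}
    (h0 : x.a.re = y.a.re) (h1 : x.a.imI = y.a.imI) (h2 : x.a.imJ = y.a.imJ)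
    (h3 : x.a.imK = y.a.imK) (h4 : x.b.re = y.b.re) (h5 : x.b.imI = y.b.imI)
    (h6 : x.b.imJ = y.b.imJ) (h7 : x.b.imK = y.b.imK) : x = y :=
  Oct.ext (QuaternionAlgebra.ext h0 h1 h2 h3) (QuaternionAlgebra.ext h4 h5 h6 h7)

lemma mul_a_re (x y : Oct) : (x * y).a.re =
    x.a.re * y.a.re - x.a.imI * y.a.imI - x.a.imJ * y.a.imJ - x.a.imK * y.a.imK
      - x.b.re * y.b.re - x.b.imI * y.b.imI - x.b.imJ * y.b.imJ - x.b.imK * y.b.imK := by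
  simp [mul_a]; ring

lemma mul_a_imI (x y : Oct) : (x * y).a.imI =
    x.a.re * y.a.imI + x.a.imI * y.a.re + x.a.imJ * y.a.imK - x.a.imK * y.a.imJ
      + x.b.re * y.b.imI - x.b.imI * y.b.re - x.b.imJ * y.b.imK + x.b.imK * y.b.imJ := by
  simp [mul_a]; ring

lemma mul_a_imJ (x y : Oct) : (x * y).a.imJ =
    x.a.re * y.a.imJ - x.a.imI * y.a.imK + x.a.imJ * y.a.re + x.a.imK * y.a.imI
      + x.b.re * y.b.imJ + x.b.imI * y.b.imK - x.b.imJ * y.b.re - x.b.imK * y.b.imI := by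
  simp [mul_a]; ring

lemma mul_a_imK (x y : Oct) : (x * y).a.imK =
    x.a.re * y.a.imK + x.a.imI * y.a.imJ - x.a.imJ * y.a.imI + x.a.imK * y.a.re
      + x.b.re * y.b.imK - x.b.imI * y.b.imJ + x.b.imJ * y.b.imI - x.b.imK * y.b.re := by
  simp [mul_a]; ring

lemma mul_b_re (x y : Oct) : (x * y).b.re =
    x.a.re * y.b.re - x.a.imI * y.b.imI - x.a.imJ * y.b.imJ - x.a.imK * y.b.imK
      + x.b.re * y.a.re + x.b.imI * y.a.imI + x.b.imJ * y.a.imJ + x.b.imK * y.a.imK := by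
  simp [mul_b]; ring

lemma mul_b_imI (x y : Oct) : (x * y).b.imI =
    x.a.re * y.b.imI + x.a.imI * y.b.re - x.a.imJ * y.b.imK + x.a.imK * y.b.imJ
      - x.b.re * y.a.imI + x.b.imI * y.a.re - x.b.imJ * y.a.imK + x.b.imK * y.a.imJ := by
  simp [mul_b]; ring

lemma mul_b_imJ (x y : Oct) : (x * y).b.imJ =
    x.a.re * y.b.imJ + x.a.imI * y.b.imK + x.a.imJ * y.b.re - x.a.imK * y.b.imI
      - x.b.re * y.a.imJ + x.b.imI * y.a.imK + x.b.imJ * y.a.re - x.b.imK * y.a.imI := by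
  simp [mul_b]; ring

lemma mul_b_imK (x y : Oct) : (x * y).b.imK =
    x.a.re * y.b.imK - x.a.imI * y.b.imJ + x.a.imJ * y.b.imI + x.a.imK * y.b.re
      - x.b.re * y.a.imK - x.b.imI * y.a.imJ + x.b.imJ * y.a.imI + x.b.imK * y.a.re := by
  simp [mul_b]; ring

lemma e_a_re (i : Fin 8) : (e i).a.re = ![1, 0, 0, 0, 0, 0, 0, 0] i := by
  fin_cases i <;> rfl

lemma e_a_imI (i : Fin 8) : (e i).a.imI = ![0, 1, 0, 0, 0, 0, 0, 0] i := by
  fin_cases i <;> rfl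

lemma e_a_imJ (i : Fin 8) : (e i).a.imJ = ![0, 0, 1, 0, 0, 0, 0, 0] i := by
  fin_cases i <;> rfl

lemma e_a_imK (i : Fin 8) : (e i).a.imK = ![0, 0, 0, 1, 0, 0, 0, 0] i := by
  fin_cases i <;> rfl

lemma e_b_re (i : Fin 8) : (e i).b.re = ![0, 0, 0, 0, 1, 0, 0, 0] i := by
  fin_cases i <;> rfl

lemma e_b_imI (i : Fin 8) : (e i).b.imI = ![0, 0, 0, 0, 0, 1, 0, 0] i := by
  fin_cases i <;> rfl

lemma e_b_imJ (i : Fin 8) : (e i).b.imJ = ![0, 0, 0, 0, 0, 0, 1, 0] i := by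
  fin_cases i <;> rfl

lemma e_b_imK (i : Fin 8) : (e i).b.imK = ![0, 0, 0, 0, 0, 0, 0, 1] i := by
  fin_cases i <;> rfl

lemma conj_a (x : Oct) : (conj x).a = star x.a := rfl
lemma conj_b (x : Oct) : (conj x).b = -x.b := rfl

lemma one_mul' (p : Oct) : 1 * p = p := by
  apply ext_coords <;> simp [mul_a, mul_b, one_a, one_b]

lemma mul_one' (p : Oct) : p * 1 = p := by
  apply ext_coords <;> simp [mul_a, mul_b, one_a, one_b]

lemma add_mul' (p q r : Oct) : (p + q) * r = p * r + q * r := by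
  apply Oct.ext
  · simp only [mul_a, add_a, add_b, add_mul, mul_add]; abel
  · simp only [mul_b, add_a, add_b, add_mul, mul_add]; abel

lemma mul_add' (p q r : Oct) : p * (q + r) = p * q + p * r :=
  (lmulLin p).map_add q r

lemma smul_mul' (t : ℝ) (p q : Oct) : (t • p) * q = t • (p * q) := by
  apply Oct.ext <;> simp [mul_a, mul_b, smul_a, smul_b, smul_sub]

lemma mul_smul' (t : ℝ) (p q : Oct) : p * (t • q) = t • (p * q) :=
  (lmulLin p).map_smul t q

/-- Right alternativity of the octonions. -/
lemma mul_mul_self (p q : Oct) : (p * q) * q = p * (q * q) := by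
  apply ext_coords <;> simp only [mul_a_re, mul_a_imI, mul_a_imJ, mul_a_imK, mul_b_re, mul_b_imI, mul_b_imJ, mul_b_imK] <;> ring

/-- The real part of an associator of octonions vanishes. -/
lemma re_assoc (p q r : Oct) : re ((r * p) * q) = re (r * (p * q)) := by
  simp only [re, mul_a_re, mul_a_imI, mul_a_imJ, mul_a_imK, mul_b_re, mul_b_imI, mul_b_imJ, mul_b_imK]; ring

lemma re_mul_conj_e (r : Oct) (i : Fin 8) : re (r * conj (e i)) =
    ![r.a.re, r.a.imI, r.a.imJ, r.a.imK, r.b.re, r.b.imI, r.b.imJ, r.b.imK] i := by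
  fin_cases i <;>
    simp [re, conj_a, conj_b, mul_a_re, e_a_re, e_a_imI, e_a_imJ, e_a_imK, e_b_re, e_b_imI, e_b_imJ, e_b_imK]

lemma one_eq_e : (1 : Oct) = e 0 := rfl

/-- An octonion is the combination of the basis with its coordinates. -/
lemma sum_re_mul_conj (r : Oct) : ∑ i : Fin 8, re (r * conj (e i)) • e i = r := by
  simp only [re_mul_conj_e]
  apply ext_coords <;>
    simp [Fin.sum_univ_succ, add_a, add_b, smul_a, smul_b,
      e_a_re, e_a_imI, e_a_imJ, e_a_imK, e_b_re, e_b_imI, e_b_imJ, e_b_imK]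

lemma mem_span_range_e (p : Oct) : p ∈ Submodule.span ℝ (Set.range e) := by
  rw [← sum_re_mul_conj p]
  exact Submodule.sum_mem _ fun i _ =>
    Submodule.smul_mem _ _ (Submodule.subset_span ⟨i, rfl⟩)

/-- The formula defining the real-part projection, in the octonions. -/
lemma re_formula (p : Oct) :
    (5 / 12 : ℝ) • p - (1 / 12 : ℝ) • ∑ i : Fin 7, (e i.succ * p) * e i.succ = re p • 1 := by
  apply ext_coords <;>
    simp [Fin.sum_univ_succ, re, add_a, add_b, smul_a, smul_b, sub_a, sub_b, one_eq_e,
      mul_a_re, mul_a_imI, mul_a_imJ, mul_a_imK, mul_b_re, mul_b_imI, mul_b_imJ, mul_b_imK,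
      e_a_re, e_a_imI, e_a_imJ, e_a_imK, e_b_re, e_b_imI, e_b_imJ, e_b_imK] <;> ring

lemma norm_sq_eq (p : Oct) : ‖p‖ ^ 2 =
    p.a.re ^ 2 + p.a.imI ^ 2 + p.a.imJ ^ 2 + p.a.imK ^ 2 +
      (p.b.re ^ 2 + p.b.imI ^ 2 + p.b.imJ ^ 2 + p.b.imK ^ 2) := by
  rw [← Quaternion.normSq_def', ← Quaternion.normSq_def', Quaternion.normSq_eq_norm_mul_self,
    Quaternion.normSq_eq_norm_mul_self, ← sq, ← sq]
  exact WithLp.prod_norm_sq_eq_of_L2 (toLp p)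

/-- A purely imaginary octonion of norm one is an imaginary unit, and conversely. -/
lemma mem_unitSphere_iff {J : Oct} : J ∈ unitSphere ↔ J.a.re = 0 ∧ ‖J‖ ^ 2 = 1 := by
  rw [norm_sq_eq]
  constructor
  · intro h
    have h' : J * J = -1 := h
    have h0 := congrArg (fun x : Oct => x.a.re) h'
    have h1 := congrArg (fun x : Oct => x.a.imI) h'
    have h2 := congrArg (fun x : Oct => x.a.imJ) h'
    have h3 := congrArg (fun x : Oct => x.a.imK) h'
    have h4 := congrArg (fun x : Oct => x.b.re) h'
    have h5 := congrArg (fun x : Oct => x.b.imI) h'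
    have h6 := congrArg (fun x : Oct => x.b.imJ) h'
    have h7 := congrArg (fun x : Oct => x.b.imK) h'
    simp [neg_a, neg_b, one_eq_e,
      mul_a_re, mul_a_imI, mul_a_imJ, mul_a_imK, mul_b_re, mul_b_imI, mul_b_imJ, mul_b_imK,
      e_a_re, e_a_imI, e_a_imJ, e_a_imK, e_b_re, e_b_imI, e_b_imJ, e_b_imK] at h0 h1 h2 h3 h4 h5 h6 h7
    have hre : J.a.re = 0 := by
      by_contra hne
      have cancel : ∀ t : ℝ, J.a.re * t = 0 → t = 0 := fun t ht =>
        (mul_eq_zero.1 ht).resolve_left hne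
      have g1 := cancel J.a.imI (by linarith)
      have g2 := cancel J.a.imJ (by linarith)
      have g3 := cancel J.a.imK (by linarith)
      have g4 := cancel J.b.re (by linarith)
      have g5 := cancel J.b.imI (by linarith)
      have g6 := cancel J.b.imJ (by linarith)
      have g7 := cancel J.b.imK (by linarith)
      rw [g1, g2, g3, g4, g5, g6, g7] at h0
      nlinarith [sq_nonneg J.a.re]
    refine ⟨hre, ?_⟩
    rw [hre] at h0 ⊢
    linarith
  · rintro ⟨h0, h1⟩
    show J * J = -1
    rw [h0] at h1
    apply ext_coords <;>
      simp [neg_a, neg_b, one_eq_e, h0,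
        mul_a_re, mul_a_imI, mul_a_imJ, mul_a_imK, mul_b_re, mul_b_imI, mul_b_imJ, mul_b_imK,
        e_a_re, e_a_imI, e_a_imJ, e_a_imK, e_b_re, e_b_imI, e_b_imJ, e_b_imK] <;> linarith

lemma norm_toSlice {J : Oct} (hJ : J ∈ unitSphere) (z : ℂ) : ‖toSlice J z‖ = ‖z‖ := by
  obtain ⟨h0, h1⟩ := mem_unitSphere_iff.1 hJ
  rw [norm_sq_eq, h0] at h1
  refine (sq_eq_sq₀ (norm_nonneg _) (norm_nonneg _)).1 ?_
  rw [norm_sq_eq, Complex.sq_norm, Complex.normSq_apply]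
  simp [toSlice, add_a, add_b, smul_a, smul_b, one_eq_e, h0,
    e_a_re, e_a_imI, e_a_imJ, e_a_imK, e_b_re, e_b_imI, e_b_imJ, e_b_imK]
  linear_combination z.im ^ 2 * h1

/-- Every octonion lies in some slice. -/
lemma exists_mem_sliceC (s : Oct) : ∃ J ∈ unitSphere, s ∈ sliceC J := by
  set w : Oct := s - re s • 1 with hw
  have hw0 : w.a.re = 0 := by simp [hw, sub_a, smul_a, re, one_eq_e, e_a_re]
  rcases eq_or_ne w 0 with h | h
  · refine ⟨e 1, mem_unitSphere_iff.2 ⟨?_, ?_⟩, re s, 0, ?_⟩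
    · simp [e_a_re]
    · rw [norm_sq_eq]
      simp [e_a_re, e_a_imI, e_a_imJ, e_a_imK, e_b_re, e_b_imI, e_b_imJ, e_b_imK]
    · rw [zero_smul, add_zero, ← sub_eq_zero, ← hw, h]
  · have hn : ‖w‖ ≠ 0 := norm_ne_zero_iff.2 h
    refine ⟨‖w‖⁻¹ • w, mem_unitSphere_iff.2 ⟨?_, ?_⟩, re s, ‖w‖, ?_⟩
    · simp [smul_a, hw0]
    · rw [norm_smul, norm_inv, norm_norm, inv_mul_cancel₀ hn, one_pow]
    · rw [smul_smul, mul_inv_cancel₀ hn, one_smul, hw]; abel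

lemma e_mul_self {i : Fin 8} (hi : i ≠ 0) : e i * e i = -1 := by
  refine mem_unitSphere_iff.2 ⟨?_, ?_⟩
  · revert hi; fin_cases i <;> simp [e_a_re]
  · rw [norm_sq_eq]
    fin_cases i <;> simp [e_a_re, e_a_imI, e_a_imJ, e_a_imK, e_b_re, e_b_imI, e_b_imJ, e_b_imK]

lemma mul_eq_neg_mul {p q : Oct} (hp : p.a.re = 0) (hq : q.a.re = 0)
    (h : p.a.imI * q.a.imI + p.a.imJ * q.a.imJ + p.a.imK * q.a.imK + p.b.re * q.b.re +
      p.b.imI * q.b.imI + p.b.imJ * q.b.imJ + p.b.imK * q.b.imK = 0) : p * q = -(q * p) := by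
  apply ext_coords <;>
    simp [neg_a, neg_b, hp, hq,
      mul_a_re, mul_a_imI, mul_a_imJ, mul_a_imK, mul_b_re, mul_b_imI, mul_b_imJ, mul_b_imK] <;>
    linarith

lemma e_mul_anticomm {i j : Fin 8} (hi : i ≠ 0) (hj : j ≠ 0) (hij : i ≠ j) :
    e i * e j = -(e j * e i) := by
  refine mul_eq_neg_mul ?_ ?_ ?_
  · revert hi; fin_cases i <;> simp [e_a_re]
  · revert hj; fin_cases j <;> simp [e_a_re]
  · revert hij
    fin_cases i <;> fin_cases j <;>
      simp [e_a_imI, e_a_imJ, e_a_imK, e_b_re, e_b_imI, e_b_imJ, e_b_imK]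

/-- An oriented line of the Fano plane of the octonionic multiplication table. -/
def IsFanoLine (i j k : Fin 8) : Prop :=
  e i * e j = e k ∧ e j * e k = e i ∧ e k * e i = e j

lemma isFanoLine_123 : IsFanoLine 1 2 3 := by
  refine ⟨?_, ?_, ?_⟩ <;> apply ext_coords <;>
    simp [mul_a_re, mul_a_imI, mul_a_imJ, mul_a_imK, mul_b_re, mul_b_imI, mul_b_imJ, mul_b_imK,
      e_a_re, e_a_imI, e_a_imJ, e_a_imK, e_b_re, e_b_imI, e_b_imJ, e_b_imK]

lemma isFanoLine_145 : IsFanoLine 1 4 5 := by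
  refine ⟨?_, ?_, ?_⟩ <;> apply ext_coords <;>
    simp [mul_a_re, mul_a_imI, mul_a_imJ, mul_a_imK, mul_b_re, mul_b_imI, mul_b_imJ, mul_b_imK,
      e_a_re, e_a_imI, e_a_imJ, e_a_imK, e_b_re, e_b_imI, e_b_imJ, e_b_imK]

lemma isFanoLine_246 : IsFanoLine 2 4 6 := by
  refine ⟨?_, ?_, ?_⟩ <;> apply ext_coords <;>
    simp [mul_a_re, mul_a_imI, mul_a_imJ, mul_a_imK, mul_b_re, mul_b_imI, mul_b_imJ, mul_b_imK,
      e_a_re, e_a_imI, e_a_imJ, e_a_imK, e_b_re, e_b_imI, e_b_imJ, e_b_imK]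

lemma isFanoLine_347 : IsFanoLine 3 4 7 := by
  refine ⟨?_, ?_, ?_⟩ <;> apply ext_coords <;>
    simp [mul_a_re, mul_a_imI, mul_a_imJ, mul_a_imK, mul_b_re, mul_b_imI, mul_b_imJ, mul_b_imK,
      e_a_re, e_a_imI, e_a_imJ, e_a_imK, e_b_re, e_b_imI, e_b_imJ, e_b_imK]

lemma isFanoLine_176 : IsFanoLine 1 7 6 := by
  refine ⟨?_, ?_, ?_⟩ <;> apply ext_coords <;>
    simp [mul_a_re, mul_a_imI, mul_a_imJ, mul_a_imK, mul_b_re, mul_b_imI, mul_b_imJ, mul_b_imK,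
      e_a_re, e_a_imI, e_a_imJ, e_a_imK, e_b_re, e_b_imI, e_b_imJ, e_b_imK]

lemma isFanoLine_257 : IsFanoLine 2 5 7 := by
  refine ⟨?_, ?_, ?_⟩ <;> apply ext_coords <;>
    simp [mul_a_re, mul_a_imI, mul_a_imJ, mul_a_imK, mul_b_re, mul_b_imI, mul_b_imJ, mul_b_imK,
      e_a_re, e_a_imI, e_a_imJ, e_a_imK, e_b_re, e_b_imI, e_b_imJ, e_b_imK]

lemma isFanoLine_365 : IsFanoLine 3 6 5 := by
  refine ⟨?_, ?_, ?_⟩ <;> apply ext_coords <;>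
    simp [mul_a_re, mul_a_imI, mul_a_imJ, mul_a_imK, mul_b_re, mul_b_imI, mul_b_imJ, mul_b_imK,
      e_a_re, e_a_imI, e_a_imJ, e_a_imK, e_b_re, e_b_imI, e_b_imJ, e_b_imK]

end Oct

lemma eq_zero_of_eq_neg {E : Type*} [AddCommGroup E] [Module ℝ E] {x : E} (h : x = -x) :
    x = 0 := by
  have h2 : (2 : ℝ) • x = 0 := by
    rw [two_smul]
    nth_rewrite 1 [h]
    exact neg_add_cancel x
  exact (smul_eq_zero.1 h2).resolve_left two_ne_zero

section Bimodule

variable {V : Type*} [NormedAddCommGroup V] [NormedSpace ℝ V] [OctBimodule V]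

lemma lmo_add (p q : Oct) (x : V) : lmo (p + q) x = lmo p x + lmo q x := by
  simp [lmo]

lemma lmo_neg (p : Oct) (x : V) : lmo (-p) x = -lmo p x := by
  have h : OctBimodule.lm (V := V) (-p) = -OctBimodule.lm p := map_neg _ p
  simp only [lmo, h]
  rfl

lemma lmo_smul (t : ℝ) (p : Oct) (x : V) : lmo (t • p) x = t • lmo p x := by
  simp [lmo]

lemma lmo_zero (x : V) : lmo (0 : Oct) x = 0 := by
  simp [lmo]

lemma rmo_zero (x : V) : rmo (0 : Oct) x = 0 := by
  simp [rmo]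

lemma lmo_one (x : V) : lmo (1 : Oct) x = x := OctBimodule.lm_one x

lemma rmo_add (p q : Oct) (x : V) : rmo (p + q) x = rmo p x + rmo q x := by
  simp [rmo]

lemma rmo_smul (t : ℝ) (p : Oct) (x : V) : rmo (t • p) x = t • rmo p x := by
  simp [rmo]

lemma rmo_one (x : V) : rmo (1 : Oct) x = x := OctBimodule.rm_one x

lemma rmo_lmo (p q : Oct) (x : V) :
    rmo p (lmo q x) = lmo (p * q) x - lmo p (lmo q x) + lmo q (rmo p x) := by
  have h : lmo (p * q) x - lmo p (lmo q x) = rmo p (lmo q x) - lmo q (rmo p x) :=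
    OctBimodule.assoc_cyc₁ p q x
  rw [h]; abel

lemma rmo_rmo (p q : Oct) (x : V) :
    rmo q (rmo p x) = rmo (p * q) x + (lmo (p * q) x - lmo p (lmo q x)) := by
  have h : lmo (p * q) x - lmo p (lmo q x) = rmo q (rmo p x) - rmo (p * q) x :=
    OctBimodule.assoc_cyc₂ p q x
  rw [h]; abel

lemma lmo_lmo_self (p : Oct) (x : V) : lmo p (lmo p x) = lmo (p * p) x := by
  have h : lmo (p * p) x - lmo p (lmo p x) = -(lmo (p * p) x - lmo p (lmo p x)) :=
    OctBimodule.assoc_alt p p x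
  exact (sub_eq_zero.1 (eq_zero_of_eq_neg h)).symm

lemma rmo_rmo_self (p : Oct) (x : V) : rmo p (rmo p x) = rmo (p * p) x := by
  rw [rmo_rmo, lmo_lmo_self, sub_self, add_zero]

lemma rmo_lmo_self (p : Oct) (x : V) : rmo p (lmo p x) = lmo p (rmo p x) := by
  rw [rmo_lmo, lmo_lmo_self, sub_self, zero_add]

lemma lmo_lmo_of_sq {p : Oct} (hp : p * p = -1) (x : V) : lmo p (lmo p x) = -x := by
  rw [lmo_lmo_self, hp, lmo_neg, lmo_one]

lemma lmo_anticomm {p q : Oct} (h : p * q = -(q * p)) (x : V) :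
    lmo p (lmo q x) = -lmo q (lmo p x) := by
  have h' : lmo (p * q) x - lmo p (lmo q x) = -(lmo (q * p) x - lmo q (lmo p x)) :=
    OctBimodule.assoc_alt p q x
  rw [h, lmo_neg] at h'
  have h2 : lmo p (lmo q x) =
      -lmo (q * p) x - (-lmo (q * p) x - lmo p (lmo q x)) := by abel
  rw [h2, h']; abel

/-- Right multiplication by an imaginary unit is minus the left one on associators. -/
lemma rmo_assoc {p q : Oct} (hq : q * q = -1) (x : V) :
    rmo q (lmo (p * q) x - lmo p (lmo q x)) = -lmo q (lmo (p * q) x - lmo p (lmo q x)) := by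
  have hpq : (p * q) * q = -p := by
    rw [mul_mul_self, hq]
    have := mul_smul' (-1) p 1
    rwa [neg_one_smul, neg_one_smul, mul_one'] at this
  have h1 := rmo_rmo p q (lmo q x)
  have h2 := congrArg (lmo q) (rmo_rmo p q x)
  have h3 : rmo q (rmo p (lmo q x)) =
      rmo q (lmo (p * q) x - lmo p (lmo q x)) + lmo q (rmo q (rmo p x)) := by
    rw [rmo_lmo p q x, map_add, rmo_lmo_self]
  rw [rmo_lmo (p * q) q x, hpq, lmo_lmo_of_sq hq] at h1
  simp only [map_add, map_sub, map_neg, lmo_neg] at h1 h2 h3 ⊢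
  linear_combination (norm := module) h1 - h3 - h2

lemma rmo_assoc' {p q : Oct} (hp : p * p = -1) (x : V) :
    rmo p (lmo (p * q) x - lmo p (lmo q x)) = -lmo p (lmo (p * q) x - lmo p (lmo q x)) := by
  have h : lmo (p * q) x - lmo p (lmo q x) = -(lmo (q * p) x - lmo q (lmo p x)) :=
    OctBimodule.assoc_alt p q x
  rw [h, map_neg, map_neg, rmo_assoc hp]

/-- Left multiplication by a basis octonion. -/
def le (i : Fin 8) : V →L[ℝ] V := lmo (e i)

lemma le_sq {i : Fin 8} (hi : i ≠ 0) (x : V) : le i (le i x) = -x :=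
  lmo_lmo_of_sq (e_mul_self hi) x

lemma le_anticomm {i j : Fin 8} (hi : i ≠ 0) (hj : j ≠ 0) (hij : i ≠ j) (x : V) :
    le i (le j x) = -le j (le i x) :=
  lmo_anticomm (e_mul_anticomm hi hj hij) x

lemma le_eq_zero {i : Fin 8} (hi : i ≠ 0) {x : V} (h : le i x = 0) : x = 0 := by
  rw [← neg_eq_zero, ← le_sq hi x, h, map_zero]

/-- If the triple product over a line through `j` acts as the identity on `z`, then left and
right multiplications by `e j` are opposite on `z`. -/
lemma rmo_of_triple {j m l : Fin 8} (hj : j ≠ 0) (hm : m ≠ 0) (hl : l ≠ 0) (hjl : j ≠ l)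
    (hml : m ≠ l) (h : e j * e m = e l) {z : V} (hz : le l (le j (le m z)) = z) :
    rmo (e j) z = -le j z := by
  have h1 := rmo_assoc' (q := e m) (e_mul_self hj) (le l z)
  rw [h] at h1
  have h2 : lmo (e l) (le l z) - lmo (e j) (lmo (e m) (le l z)) = (-2 : ℝ) • z := by
    change le l (le l z) - le j (le m (le l z)) = _
    rw [le_sq hl, le_anticomm hm hl hml, map_neg, le_anticomm hj hl hjl, hz]
    module
  rw [h2, map_smul, map_smul, ← smul_neg] at h1
  exact smul_right_injective V (by norm_num : (-2 : ℝ) ≠ 0) h1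

/-- The associator of `e i`, `e j` and `x` vanishes, where `e i * e j = e k`. -/
def Nuc (i j k : Fin 8) (x : V) : Prop := le k x = le i (le j x)

lemma rmo_le_of_nuc {j m l k : Fin 8} (hj : j ≠ 0) (hm : m ≠ 0) (hl : l ≠ 0) (hk : k ≠ 0)
    (hjl : j ≠ l) (hml : m ≠ l) (hkj : k ≠ j) (hkm : k ≠ m) (hkl : k ≠ l)
    (h : e j * e m = e l) {x : V} (hx : Nuc j m l x) :
    rmo (e j) (le k x) = -le j (le k x) := by
  refine rmo_of_triple hj hm hl hjl hml h ?_
  rw [le_anticomm hm hk hkm.symm, map_neg, map_neg, le_anticomm hj hk hkj.symm, map_neg,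
    neg_neg, le_anticomm hl hk hkl.symm, ← hx, le_sq hl, map_neg, neg_neg]

lemma rmo_eq_le_of_nuc {j m l k n : Fin 8} (hj : j ≠ 0) (hm : m ≠ 0) (hl : l ≠ 0) (hk : k ≠ 0)
    (hjl : j ≠ l) (hml : m ≠ l) (hkj : k ≠ j) (hkm : k ≠ m) (hkl : k ≠ l)
    (h : e j * e m = e l) (h' : e j * e k = e n) {x : V} (hx : Nuc j m l x)
    (hx' : Nuc j k n x) : rmo (e j) x = le j x := by
  have h1 := rmo_le_of_nuc hj hm hl hk hjl hml hkj hkm hkl h hx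
  have h2 : rmo (e j) (le k x) = le n x - le j (le k x) + le k (rmo (e j) x) := by
    rw [le, rmo_lmo, h']; rfl
  rw [show le n x = le j (le k x) from hx', sub_self, zero_add, h1,
    le_anticomm hj hk hkj.symm, neg_neg, ← sub_eq_zero, ← map_sub] at h2
  exact (sub_eq_zero.1 (le_eq_zero hk h2)).symm

lemma Nuc.sub {i j k : Fin 8} {x y : V} (hx : Nuc i j k x) (hy : Nuc i j k y) :
    Nuc i j k (x - y) := by
  simp only [Nuc, map_sub] at *
  rw [hx, hy]

lemma Nuc.add {i j k : Fin 8} {x y : V} (hx : Nuc i j k x) (hy : Nuc i j k y) :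
    Nuc i j k (x + y) := by
  simp only [Nuc, map_add] at *
  rw [hx, hy]

lemma Nuc.rotate {i j k : Fin 8} (hi : i ≠ 0) (hj : j ≠ 0) (hij : i ≠ j) {x : V}
    (hx : Nuc i j k x) : Nuc j k i x := by
  unfold Nuc at *
  rw [hx, le_anticomm hj hi hij.symm, le_sq hj, map_neg, neg_neg]

lemma triple_triple {a b c : Fin 8} (ha : a ≠ 0) (hb : b ≠ 0) (hc : c ≠ 0) (hab : a ≠ b)
    (hac : a ≠ c) (hbc : b ≠ c) (x : V) :
    le c (le a (le b (le c (le a (le b x))))) = x := by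
  rw [le_anticomm hb hc hbc, le_anticomm hb ha hab.symm, le_sq hb]
  simp only [map_neg, neg_neg]
  rw [le_anticomm ha hc hac, le_sq ha]
  simp only [map_neg, neg_neg]
  rw [le_sq hc, neg_neg]

/-- Triple products over lines meeting in `j` commute. -/
lemma Nuc.triple {j k l m n : Fin 8} (hj : j ≠ 0) (hk : k ≠ 0) (hl : l ≠ 0) (hm : m ≠ 0)
    (hn : n ≠ 0) (hjk : j ≠ k) (hjl : j ≠ l) (hjm : j ≠ m) (hjn : j ≠ n) (hkm : k ≠ m)
    (hkn : k ≠ n) (hlm : l ≠ m) (hln : l ≠ n) {x : V} (hx : Nuc j k l x) :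
    Nuc j k l (le n (le j (le m x))) := by
  unfold Nuc at *
  rw [le_anticomm hl hn hln, le_anticomm hl hj hjl.symm, le_anticomm hl hm hlm, hx,
    le_anticomm hk hn hkn, le_anticomm hk hj hjk.symm, le_anticomm hk hm hkm]
  simp only [map_neg, neg_neg]
  rw [le_anticomm hj hn hjn, le_anticomm hm hj hjm.symm]
  simp only [map_neg, neg_neg]

/-- If two of the associators given by the three lines through `j` vanish at `x`, so does
the third. -/
lemma Nuc.third {j k l m n p q : Fin 8} (hnd : [0, j, k, l, m, n, p, q].Nodup)
    (hl : e j * e k = e l) (hn : e j * e m = e n) (hq : e j * e p = e q) {x : V}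
    (hx : Nuc j k l x) (hx' : Nuc j m n x) : Nuc j p q x := by
  simp only [List.nodup_cons, List.mem_cons, List.not_mem_nil, not_or, or_false,
    not_false_eq_true, List.nodup_nil, and_true] at hnd
  obtain ⟨⟨j0, k0, l0, m0, n0, p0, q0⟩, ⟨jk, jl, jm, jn, jp, jq⟩, ⟨kl, km, kn, kp, kq⟩,
    ⟨lm, ln, lp, lq⟩, ⟨mn, mp, mq⟩, ⟨np, nq⟩, pq⟩ := hnd
  have j0' := Ne.symm j0
  have k0' := Ne.symm k0
  have l0' := Ne.symm l0
  have m0' := Ne.symm m0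
  have n0' := Ne.symm n0
  have p0' := Ne.symm p0
  have q0' := Ne.symm q0
  set y := x + le q (le j (le p x)) with hy
  have y1 : Nuc j k l y := hx.add (hx.triple j0' k0' l0' p0' q0' jk jl jp jq kp kq lp lq)
  have y2 : Nuc j m n y := hx'.add (hx'.triple j0' m0' n0' p0' q0' jm jn jp jq mp mq np nq)
  have y3 : le q (le j (le p y)) = y := by
    rw [hy]
    simp only [map_add]
    rw [triple_triple j0' p0' q0' jp jq pq, add_comm]
  have r1 := rmo_of_triple j0' p0' q0' jq pq hq y3
  have r2 := rmo_eq_le_of_nuc j0' m0' n0' k0' jn mn (Ne.symm jk) km kn hn hl y2 y1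
  have y0 : y = 0 := le_eq_zero j0' (eq_zero_of_eq_neg (r2.symm.trans r1))
  have h := congrArg (le q) y0
  rw [hy, map_add, le_sq q0', map_zero] at h
  exact add_neg_eq_zero.1 h

/-- The associators given by the line `(i, j, k)` vanish at `x`. -/
def NucLine (i j k : Fin 8) (x : V) : Prop := IsFanoLine i j k ∧ Nuc i j k x

lemma NucLine.rotate {i j k : Fin 8} (hi : i ≠ 0) (hj : j ≠ 0) (hij : i ≠ j) {x : V}
    (h : NucLine i j k x) : NucLine j k i x :=
  ⟨⟨h.1.2.1, h.1.2.2, h.1.1⟩, h.2.rotate hi hj hij⟩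

lemma NucLine.lmo_mul {i j k : Fin 8} {x : V} (h : NucLine i j k x) :
    lmo (e i * e j) x = lmo (e i) (lmo (e j) x) := by
  rw [h.1.1]
  exact h.2

lemma lmo_mul_swap {p q : Oct} {x : V} (h : lmo (p * q) x = lmo p (lmo q x)) :
    lmo (q * p) x = lmo q (lmo p x) := by
  have h' : lmo (p * q) x - lmo p (lmo q x) = -(lmo (q * p) x - lmo q (lmo p x)) :=
    OctBimodule.assoc_alt p q x
  rw [h, sub_self, eq_comm, neg_eq_zero] at h'
  exact sub_eq_zero.1 h'

/-- An element at which left multiplication is multiplicative and agrees with right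
multiplication on basis octonions is real. -/
lemma mem_ReSet_of_basis {x : V}
    (h : ∀ i j, lmo (e i * e j) x = lmo (e i) (lmo (e j) x))
    (h' : ∀ i, lmo (e i) x = rmo (e i) x) : x ∈ ReSet V := by
  have h1 : ∀ i q, lmo (e i * q) x = lmo (e i) (lmo q x) := by
    intro i q
    induction mem_span_range_e q using Submodule.span_induction with
    | mem q hq => obtain ⟨j, rfl⟩ := hq; exact h i j
    | zero => rw [← zero_smul ℝ (1 : Oct), mul_smul', zero_smul, zero_smul, lmo_zero, map_zero]
    | add p q _ _ hp hq => rw [mul_add', lmo_add, lmo_add, map_add, hp, hq]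
    | smul t p _ hp => rw [mul_smul', lmo_smul, lmo_smul, map_smul, hp]
  refine ⟨fun p q => ?_, fun p => ?_⟩
  · induction mem_span_range_e p using Submodule.span_induction with
    | mem p hp => obtain ⟨i, rfl⟩ := hp; exact h1 i q
    | zero => rw [← zero_smul ℝ (1 : Oct), Oct.smul_mul', zero_smul, zero_smul, lmo_zero, lmo_zero]
    | add p p' _ _ hp hp' => rw [add_mul', lmo_add, lmo_add, hp, hp']
    | smul t p _ hp => rw [Oct.smul_mul', lmo_smul, lmo_smul, hp]
  · induction mem_span_range_e p using Submodule.span_induction with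
    | mem p hp => obtain ⟨i, rfl⟩ := hp; exact h' i
    | zero => rw [lmo_zero, rmo_zero]
    | add p p' _ _ hp hp' => rw [lmo_add, rmo_add, hp, hp']
    | smul t p _ hp => rw [lmo_smul, rmo_smul, hp]

/-- Vanishing of the associators given by three independent lines forces an element to be
real. -/
lemma mem_ReSet_of_nuc {x : V} (h1 : Nuc 1 2 3 x) (h2 : Nuc 1 4 5 x) (h3 : Nuc 2 4 6 x) :
    x ∈ ReSet V := by
  have a1 : NucLine 1 2 3 x := ⟨isFanoLine_123, h1⟩
  have a2 : NucLine 1 4 5 x := ⟨isFanoLine_145, h2⟩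
  have a3 : NucLine 2 4 6 x := ⟨isFanoLine_246, h3⟩
  have b1 := a1.rotate (by decide) (by decide) (by decide)
  have b2 := a2.rotate (by decide) (by decide) (by decide)
  have b3 := a3.rotate (by decide) (by decide) (by decide)
  have c1 := b1.rotate (by decide) (by decide) (by decide)
  have c2 := b2.rotate (by decide) (by decide) (by decide)
  have c3 := b3.rotate (by decide) (by decide) (by decide)
  have a4 : NucLine 1 7 6 x :=
    ⟨isFanoLine_176, a1.2.third (by decide) a1.1.1 a2.1.1 isFanoLine_176.1 a2.2⟩
  have a5 : NucLine 2 5 7 x :=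
    ⟨isFanoLine_257, b1.2.third (by decide) b1.1.1 a3.1.1 isFanoLine_257.1 a3.2⟩
  have b4 := a4.rotate (by decide) (by decide) (by decide)
  have b5 := a5.rotate (by decide) (by decide) (by decide)
  have c4 := b4.rotate (by decide) (by decide) (by decide)
  have c5 := b5.rotate (by decide) (by decide) (by decide)
  have b6 : NucLine 4 7 3 x :=
    ⟨⟨isFanoLine_347.2.1, isFanoLine_347.2.2, isFanoLine_347.1⟩,
      b2.2.third (by decide) b2.1.1 b3.1.1 isFanoLine_347.2.1 b3.2⟩
  have c6 := b6.rotate (by decide) (by decide) (by decide)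
  have a6 := c6.rotate (by decide) (by decide) (by decide)
  have a7 : NucLine 3 6 5 x :=
    ⟨isFanoLine_365, c1.2.third (by decide) c1.1.1 a6.1.1 isFanoLine_365.1 a6.2⟩
  have b7 := a7.rotate (by decide) (by decide) (by decide)
  have c7 := b7.rotate (by decide) (by decide) (by decide)
  have hdiag : ∀ i j, i = 0 ∨ j = 0 ∨ i = j →
      lmo (e i * e j) x = lmo (e i) (lmo (e j) x) := by
    rintro i j (rfl | rfl | rfl)
    · rw [← one_eq_e, one_mul', lmo_one]
    · rw [← one_eq_e, mul_one', lmo_one]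
    · exact (lmo_lmo_self _ x).symm
  let L : List (Fin 8 × Fin 8) := [(1, 2), (2, 3), (3, 1), (1, 4), (4, 5), (5, 1), (2, 4), (4, 6),
    (6, 2), (1, 7), (7, 6), (6, 1), (2, 5), (5, 7), (7, 2), (3, 4), (4, 7), (7, 3), (3, 6), (6, 5),
    (5, 3)]
  have hlines : ∀ t ∈ L, lmo (e t.1 * e t.2) x = lmo (e t.1) (lmo (e t.2) x) := by
    simp only [L, List.forall_mem_cons]
    exact ⟨a1.lmo_mul, b1.lmo_mul, c1.lmo_mul, a2.lmo_mul, b2.lmo_mul, c2.lmo_mul,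
      a3.lmo_mul, b3.lmo_mul, c3.lmo_mul, a4.lmo_mul, b4.lmo_mul, c4.lmo_mul,
      a5.lmo_mul, b5.lmo_mul, c5.lmo_mul, a6.lmo_mul, b6.lmo_mul, c6.lmo_mul,
      a7.lmo_mul, b7.lmo_mul, c7.lmo_mul, fun _ h => absurd h List.not_mem_nil⟩
  have hpairs : ∀ i j : Fin 8, (i = 0 ∨ j = 0 ∨ i = j) ∨ (i, j) ∈ L ∨ (j, i) ∈ L := by decide
  refine mem_ReSet_of_basis (fun i j => ?_) fun i => Eq.symm ?_
  · rcases hpairs i j with h | h | h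
    · exact hdiag i j h
    · exact hlines (i, j) h
    · exact lmo_mul_swap (hlines (j, i) h)
  · have key : ∀ {j m l k n : Fin 8}, NucLine j m l x → NucLine j k n x →
        (j ≠ 0 ∧ m ≠ 0 ∧ l ≠ 0 ∧ k ≠ 0 ∧ j ≠ l ∧ m ≠ l ∧ k ≠ j ∧ k ≠ m ∧ k ≠ l) →
        rmo (e j) x = lmo (e j) x := fun h h' hd =>
      rmo_eq_le_of_nuc hd.1 hd.2.1 hd.2.2.1 hd.2.2.2.1 hd.2.2.2.2.1 hd.2.2.2.2.2.1
        hd.2.2.2.2.2.2.1 hd.2.2.2.2.2.2.2.1 hd.2.2.2.2.2.2.2.2 h.1.1 h'.1.1 h.2 h'.2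
    fin_cases i
    · exact (rmo_one x).trans (lmo_one x).symm
    · exact key a1 a2 (by decide)
    · exact key a3 b1 (by decide)
    · exact key a6 c1 (by decide)
    · exact key b3 b2 (by decide)
    · exact key c2 b5 (by decide)
    · exact key c3 b7 (by decide)
    · exact key c6 b4 (by decide)

lemma nuc_of_triple {a b c : Fin 8} (hc : c ≠ 0) {x : V}
    (h : le c (le a (le b x)) = -x) : Nuc a b c x := by
  have h' := congrArg (le c) h
  rw [le_sq hc, map_neg, neg_inj] at h'
  exact h'.symm

lemma Nuc.left {i j k : Fin 8} (hi : i ≠ 0) (hj : j ≠ 0) (hk : k ≠ 0) (hij : i ≠ j)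
    (hik : i ≠ k) {x : V} (h : Nuc i j k x) : Nuc i j k (le i x) := by
  unfold Nuc at *
  rw [le_anticomm hk hi hik.symm, h, le_anticomm hj hi hij.symm, map_neg]

lemma nuc_sub_triple {a b c : Fin 8} (ha : a ≠ 0) (hb : b ≠ 0) (hc : c ≠ 0) (hab : a ≠ b)
    (hac : a ≠ c) (hbc : b ≠ c) (x : V) : Nuc a b c (x - le c (le a (le b x))) := by
  apply nuc_of_triple hc
  simp only [map_sub]
  rw [triple_triple ha hb hc hab hac hbc, neg_sub]

lemma nuc_le_add_triple {a b c k : Fin 8} (ha : a ≠ 0) (hb : b ≠ 0) (hc : c ≠ 0) (hk : k ≠ 0)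
    (hab : a ≠ b) (hac : a ≠ c) (hbc : b ≠ c) (hka : k ≠ a) (hkb : k ≠ b) (hkc : k ≠ c)
    (x : V) : Nuc a b c (le k (x + le c (le a (le b x)))) := by
  apply nuc_of_triple hc
  rw [le_anticomm hb hk hkb.symm, map_neg, map_neg, le_anticomm ha hk hka.symm, map_neg, neg_neg,
    le_anticomm hc hk hkc.symm]
  simp only [map_add]
  rw [triple_triple ha hb hc hab hac hbc, add_comm]

lemma mem_of_split {D : Submodule ℝ V} (hD : ∀ i, ∀ y ∈ D, le i y ∈ D) {k : Fin 8} (hk : k ≠ 0)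
    {x y : V} (h1 : x - y ∈ D) (h2 : le k (x + y) ∈ D) : x ∈ D := by
  have h3 := D.smul_mem (1 / 2 : ℝ) (D.sub_mem h1 (hD k _ h2))
  rw [le_sq hk] at h3
  convert h3 using 1
  module

/-- A real subspace stable under left multiplications and containing the real part is
everything. -/
lemma mem_of_ReSet_subset {D : Submodule ℝ V} (hD : ∀ i, ∀ y ∈ D, le i y ∈ D)
    (hRe : ∀ y ∈ ReSet V, y ∈ D) (x : V) : x ∈ D := by
  have s3 : ∀ x : V, Nuc 1 2 3 x → Nuc 1 4 5 x → x ∈ D := by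
    intro x h1 h2
    have h1' : Nuc 1 2 3 (le 6 (le 2 (le 4 x))) :=
      (((h1.rotate (by decide) (by decide) (by decide)).triple (by decide) (by decide)
        (by decide) (by decide) (by decide) (by decide) (by decide) (by decide) (by decide)
        (by decide) (by decide) (by decide) (by decide)).rotate (by decide) (by decide)
        (by decide)).rotate (by decide) (by decide) (by decide)
    have h2' : Nuc 1 4 5 (le 6 (le 2 (le 4 x))) := by
      have h : Nuc 1 4 5 (le 2 (le 4 (le 6 x))) :=
        (((h2.rotate (by decide) (by decide) (by decide)).triple (by decide) (by decide)
          (by decide) (by decide) (by decide) (by decide) (by decide) (by decide) (by decide)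
          (by decide) (by decide) (by decide) (by decide)).rotate (by decide) (by decide)
          (by decide)).rotate (by decide) (by decide) (by decide)
      rwa [le_anticomm (i := 4) (j := 6) (by decide) (by decide) (by decide), map_neg,
        le_anticomm (i := 2) (j := 6) (by decide) (by decide) (by decide), neg_neg] at h
    refine mem_of_split hD (k := 1) (y := le 6 (le 2 (le 4 x))) (by decide) ?_ ?_
    · exact hRe _ (mem_ReSet_of_nuc (h1.sub h1') (h2.sub h2')
        (nuc_sub_triple (by decide) (by decide) (by decide) (by decide) (by decide)
          (by decide) x))
    · exact hRe _ (mem_ReSet_of_nuc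
        ((h1.add h1').left (by decide) (by decide) (by decide) (by decide) (by decide))
        ((h2.add h2').left (by decide) (by decide) (by decide) (by decide) (by decide))
        (nuc_le_add_triple (by decide) (by decide) (by decide) (by decide) (by decide)
          (by decide) (by decide) (by decide) (by decide) (by decide) x))
  have s2 : ∀ x : V, Nuc 1 2 3 x → x ∈ D := by
    intro x h1
    have h1' : Nuc 1 2 3 (le 5 (le 1 (le 4 x))) :=
      h1.triple (by decide) (by decide)
        (by decide) (by decide) (by decide) (by decide) (by decide) (by decide) (by decide)
        (by decide) (by decide) (by decide) (by decide)
    refine mem_of_split hD (k := 2) (y := le 5 (le 1 (le 4 x))) (by decide) ?_ ?_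
    · exact s3 _ (h1.sub h1') (nuc_sub_triple (by decide) (by decide) (by decide) (by decide)
        (by decide) (by decide) x)
    · refine s3 _ ?_ (nuc_le_add_triple (by decide) (by decide) (by decide) (by decide)
        (by decide) (by decide) (by decide) (by decide) (by decide) (by decide) x)
      exact ((((h1.add h1').rotate (by decide) (by decide) (by decide)).left (by decide)
        (by decide) (by decide) (by decide) (by decide)).rotate (by decide) (by decide)
        (by decide)).rotate (by decide) (by decide) (by decide)
  exact mem_of_split hD (k := 4) (y := le 3 (le 1 (le 2 x))) (by decide)
    (s2 _ (nuc_sub_triple (by decide) (by decide) (by decide) (by decide)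
        (by decide) (by decide) x))
    (s2 _ (nuc_le_add_triple (by decide) (by decide) (by decide) (by decide)
        (by decide) (by decide) (by decide) (by decide) (by decide) (by decide) x))

/-- An `𝕆`-bimodule is spanned by the left multiples of its real elements. -/
lemma span_lmo_ReSet_induction {P : V → Prop} (h : ∀ p, ∀ n ∈ ReSet V, P (lmo p n))
    (hadd : ∀ x y, P x → P y → P (x + y)) (x : V) : P x := by
  let D : Submodule ℝ V := Submodule.span ℝ {x | ∃ p, ∃ n ∈ ReSet V, x = lmo p n}
  have hx : x ∈ D := by
    refine mem_of_ReSet_subset (fun i y hy => ?_) (fun y hy => ?_) x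
    · induction hy using Submodule.span_induction with
      | mem y hy =>
        obtain ⟨p, n, hn, rfl⟩ := hy
        refine Submodule.subset_span ⟨e i * p, n, hn, ?_⟩
        rw [hn.1]; rfl
      | zero => rw [map_zero]; exact D.zero_mem
      | add y z _ _ hy hz => rw [map_add]; exact D.add_mem hy hz
      | smul t y _ hy => rw [map_smul]; exact D.smul_mem t hy
    · exact Submodule.subset_span ⟨1, y, hy, (lmo_one y).symm⟩
  have hsmul : ∀ y ∈ D, ∀ t : ℝ, P (t • y) := by
    intro y hy
    induction hy using Submodule.span_induction with
    | mem y hy =>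
      obtain ⟨p, n, hn, rfl⟩ := hy
      intro t
      rw [← lmo_smul]
      exact h _ n hn
    | zero =>
      intro t
      have h0 := h 0 0 ⟨fun p q => by simp only [map_zero], fun p => by simp only [map_zero]⟩
      rwa [map_zero, ← smul_zero t] at h0
    | add y z _ _ hy hz => intro t; rw [smul_add]; exact hadd _ _ (hy t) (hz t)
    | smul s y _ hy => intro t; rw [smul_smul]; exact hy _
  simpa using hsmul x hx 1

lemma rmo_lmo_of_mem_ReSet {n : V} (hn : n ∈ ReSet V) (p q : Oct) :
    rmo q (lmo p n) = lmo (p * q) n := by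
  rw [rmo_lmo, hn.1 q p, sub_self, zero_add, ← hn.2 q, hn.1 p q]

lemma lmo_sum {ι : Type*} (s : Finset ι) (f : ι → Oct) (x : V) :
    lmo (∑ i ∈ s, f i) x = ∑ i ∈ s, lmo (f i) x := by
  simp [lmo]

lemma lmo_sub (p q : Oct) (x : V) : lmo (p - q) x = lmo p x - lmo q x := by
  simp [lmo]

lemma reO_lmo_of_mem_ReSet {n : V} (hn : n ∈ ReSet V) (p : Oct) :
    reO V (lmo p n) = re p • n := by
  have h : reO V (lmo p n) =
      lmo ((5 / 12 : ℝ) • p - (1 / 12 : ℝ) • ∑ i : Fin 7, (e i.succ * p) * e i.succ) n := by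
    simp only [reO, sub_apply, smul_apply,
      sum_apply, ContinuousLinearMap.comp_apply,
      ContinuousLinearMap.id_apply, lmo_sub, lmo_smul, lmo_sum, ← hn.1,
      rmo_lmo_of_mem_ReSet hn]
  rw [h, re_formula, lmo_smul, lmo_one]

lemma reO_rmo_rmo (p q : Oct) (x : V) :
    reO V (rmo q (rmo p x)) = reO V (rmo (p * q) x) := by
  refine span_lmo_ReSet_induction (P := fun x => reO V (rmo q (rmo p x)) = reO V (rmo (p * q) x))
    (fun r n hn => ?_) (fun x y hx hy => ?_) x
  · simp only [rmo_lmo_of_mem_ReSet hn, reO_lmo_of_mem_ReSet hn, re_assoc]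
  · simp only [map_add, hx, hy]

/-- An element is determined by the real parts of its right multiples. -/
lemma sum_rmo_reO (x : V) : ∑ i : Fin 8, rmo (e i) (reO V (rmo (conj (e i)) x)) = x := by
  refine span_lmo_ReSet_induction
    (P := fun x => ∑ i : Fin 8, rmo (e i) (reO V (rmo (conj (e i)) x)) = x)
    (fun r n hn => ?_) (fun x y hx hy => ?_) x
  · simp only [rmo_lmo_of_mem_ReSet hn, reO_lmo_of_mem_ReSet hn, map_smul, ← hn.2, ← lmo_smul,
      ← lmo_sum, sum_re_mul_conj]
  · simp only [map_add, Finset.sum_add_distrib, hx, hy]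

lemma eq_zero_of_reO_rmo {x : V} (h : ∀ p, reO V (rmo p x) = 0) : x = 0 := by
  rw [← sum_rmo_reO x]
  simp only [h, map_zero, Finset.sum_const_zero]

lemma exists_mem_ReSet_ne_zero [Nontrivial V] : ∃ v ∈ ReSet V, v ≠ 0 := by
  by_contra! h
  obtain ⟨x, hx⟩ := exists_ne (0 : V)
  refine hx (span_lmo_ReSet_induction (P := fun x => x = 0) (fun p n hn => ?_)
    (fun x y hx hy => ?_) x)
  · rw [h n hn, map_zero]
  · rw [hx, hy, add_zero]

lemma rmo_rmo_of_mem_ReSet {n : V} (hn : n ∈ ReSet V) (p q : Oct) :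
    rmo q (rmo p n) = rmo (p * q) n := by
  rw [← hn.2, rmo_lmo_of_mem_ReSet hn, hn.2]

/-- Right para-linear operators commute with right multiplications on the real part. -/
lemma IsRightPara.map_rmo {S : V →L[ℝ] V} (hS : IsRightPara S) {v : V} (hv : v ∈ ReSet V)
    (p : Oct) : S (rmo p v) = rmo p (S v) := by
  have h : ∀ q x, reO V (rmo q (S x)) = reO V (S (rmo q x)) := fun q x => by
    have := hS q x
    simpa only [Bop, sub_apply, ContinuousLinearMap.comp_apply, map_sub,
      sub_eq_zero] using this
  rw [← sub_eq_zero]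
  refine eq_zero_of_reO_rmo fun q => ?_
  rw [map_sub, map_sub, h, reO_rmo_rmo, h, rmo_rmo_of_mem_ReSet hv, sub_self]

/-- Right multiplication by the slice `ℂ_J`, as a representation of `ℂ`. -/
def sliceHom {J : Oct} (hJ : J ∈ unitSphere) : ℂ →ₐ[ℝ] V →L[ℝ] V :=
  Complex.lift ⟨rmo J, by
    ext x
    change rmo J (rmo J x) = -x
    rw [rmo_rmo_self, show J * J = -1 from hJ, ← neg_one_smul ℝ (1 : Oct), rmo_smul, rmo_one,
      neg_one_smul]⟩

lemma sliceHom_eq {J : Oct} (hJ : J ∈ unitSphere) (z : ℂ) :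
    (sliceHom hJ z : V →L[ℝ] V) = rmo (toSlice J z) := by
  ext x
  rw [sliceHom, Complex.lift_apply, Complex.liftAux_apply, toSlice, rmo_add, rmo_smul, rmo_smul,
    rmo_one]
  simp [Algebra.algebraMap_eq_smul_one]

lemma continuous_sliceHom {J : Oct} (hJ : J ∈ unitSphere) :
    Continuous (sliceHom hJ : ℂ → V →L[ℝ] V) :=
  LinearMap.continuous_of_finiteDimensional (sliceHom hJ : ℂ →ₐ[ℝ] V →L[ℝ] V).toLinearMap

lemma mem_sliceC_iff {J s : Oct} : s ∈ sliceC J ↔ ∃ z : ℂ, toSlice J z = s := by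
  constructor
  · rintro ⟨x, y, rfl⟩
    exact ⟨⟨x, y⟩, rfl⟩
  · rintro ⟨z, rfl⟩
    exact ⟨z.re, z.im, rfl⟩

lemma norm_sliceHom_apply {J : Oct} (hJ : J ∈ unitSphere) (z : ℂ) (x : V) :
    ‖sliceHom hJ z x‖ = ‖z‖ * ‖x‖ := by
  rw [sliceHom_eq, ← norm_toSlice hJ]
  exact OctBimodule.norm_rm _ x

lemma norm_sliceHom_le {J : Oct} (hJ : J ∈ unitSphere) (z : ℂ) :
    ‖(sliceHom hJ z : V →L[ℝ] V)‖ ≤ ‖z‖ :=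
  ContinuousLinearMap.opNorm_le_bound _ (norm_nonneg z) fun x => (norm_sliceHom_apply hJ z x).le

/-- The operators preserving a real subspace `Y` and commuting there with the right
multiplications by `ℂ_J`. -/
def sliceAlg {J : Oct} (hJ : J ∈ unitSphere) (Y : Submodule ℝ V) :
    Subalgebra ℝ (V →L[ℝ] V) where
  carrier := {A | ∀ x ∈ Y, A x ∈ Y ∧ ∀ z, A (sliceHom hJ z x) = sliceHom hJ z (A x)}
  mul_mem' := fun {A B} hA hB x hx => ⟨(hA _ (hB x hx).1).1, fun z => by
    rw [mul_apply_eq_comp, (hB x hx).2, (hA _ (hB x hx).1).2]; rfl⟩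
  add_mem' := fun {A B} hA hB x hx => ⟨Y.add_mem (hA x hx).1 (hB x hx).1, fun z => by
    rw [add_apply, add_apply, map_add, (hA x hx).2, (hB x hx).2]⟩
  algebraMap_mem' := fun t x hx => by
    simp only [Algebra.algebraMap_eq_smul_one, smul_apply,
      one_apply_eq_self, map_smul, implies_true, and_true]
    exact Y.smul_mem t hx

lemma isClosed_sliceAlg {J : Oct} (hJ : J ∈ unitSphere) {Y : Submodule ℝ V}
    (hY : IsClosed (Y : Set V)) : IsClosed (sliceAlg hJ Y : Set (V →L[ℝ] V)) := by
  have h : (sliceAlg hJ Y : Set (V →L[ℝ] V)) = ⋂ x ∈ Y, ({A | A x ∈ (Y : Set V)} ∩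
      ⋂ z, {A | A (sliceHom hJ z x) = sliceHom hJ z (A x)}) := by
    ext A
    simp [sliceAlg]
  rw [h]
  refine isClosed_biInter fun x _ => IsClosed.inter (hY.preimage (by fun_prop))
    (isClosed_iInter fun z => isClosed_eq (by fun_prop) (by fun_prop))

/-- The subspace on which all the powers of `S` commute with the right multiplications by
`ℂ_J`. -/
def powComm {J : Oct} (hJ : J ∈ unitSphere) (S : V →L[ℝ] V) : Submodule ℝ V where
  carrier := {x | ∀ (n : ℕ) z, (S ^ n) (sliceHom hJ z x) = sliceHom hJ z ((S ^ n) x)}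
  add_mem' := fun hx hy n z => by simp only [map_add, hx n z, hy n z]
  zero_mem' := fun n z => by simp only [map_zero]
  smul_mem' := fun t x hx n z => by simp only [map_smul, hx n z]

lemma isClosed_powComm {J : Oct} (hJ : J ∈ unitSphere) (S : V →L[ℝ] V) :
    IsClosed (powComm hJ S : Set V) := by
  have h : (powComm hJ S : Set V) =
      ⋂ (n : ℕ), ⋂ z, {x | (S ^ n) (sliceHom hJ z x) = sliceHom hJ z ((S ^ n) x)} := by
    ext x
    simp [powComm]
  rw [h]
  exact isClosed_iInter fun n => isClosed_iInter fun z => isClosed_eq (by fun_prop) (by fun_prop)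

lemma self_mem_sliceAlg_powComm {J : Oct} (hJ : J ∈ unitSphere) (S : V →L[ℝ] V) :
    S ∈ sliceAlg hJ (powComm hJ S) := by
  intro x hx
  have h1 : ∀ z, S (sliceHom hJ z x) = sliceHom hJ z (S x) := fun z => by simpa using hx 1 z
  refine ⟨fun n z => ?_, h1⟩
  rw [← h1, ← mul_apply_eq_comp, ← pow_succ, hx, pow_succ]
  rfl

lemma sliceHom_mem_sliceAlg_powComm {J : Oct} (hJ : J ∈ unitSphere) (S : V →L[ℝ] V) (w : ℂ) :
    sliceHom hJ w ∈ sliceAlg hJ (powComm hJ S) := by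
  have h : ∀ (z : ℂ) (y : V),
      sliceHom hJ z (sliceHom hJ w y) = sliceHom hJ (z * w) y := fun z y => by
    rw [map_mul]; rfl
  refine fun x hx => ⟨fun n z => ?_, fun z => ?_⟩
  · rw [h, hx, hx, h]
  · rw [h, mul_comm, map_mul]; rfl

lemma ringInverse_one_sub_mem {A : Type*} [NormedRing A] [NormedAlgebra ℝ A] [CompleteSpace A]
    {B : Subalgebra ℝ A} (hB : IsClosed (B : Set A)) {a : A} (ha : a ∈ B) (h : ‖a‖ < 1) :
    Ring.inverse (1 - a) ∈ B := by
  rw [NormedRing.inverse_one_sub a h]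
  have hs : HasSum (fun n : ℕ => a ^ n) (↑(Units.oneSub a h)⁻¹ : A) :=
    (summable_geometric_of_norm_lt_one h).hasSum
  exact hB.mem_of_tendsto hs (Filter.Eventually.of_forall fun s =>
    B.sum_mem fun n _ => B.pow_mem ha n)

lemma CJExtPA_of_mem_sliceAlg {J : Oct} (hJ : J ∈ unitSphere) {Y : Submodule ℝ V}
    (hY : ReSet V ⊆ Y) {S : V →L[ℝ] V} (hS : S ∈ sliceAlg hJ Y) : CJExtPA J S := by
  intro n _ v hv s hs
  obtain ⟨z, rfl⟩ := mem_sliceC_iff.1 hs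
  have h := (Subalgebra.pow_mem _ hS n v (hY hv)).2 z
  rwa [sliceHom_eq] at h

lemma ReSet_subset_powComm {J : Oct} (hJ : J ∈ unitSphere) {S : V →L[ℝ] V}
    (hS : CJExtPA J S) : ReSet V ⊆ powComm hJ S := by
  intro v hv n z
  rcases n.eq_zero_or_pos with rfl | hn
  · simp
  · rw [sliceHom_eq]
    exact hS n hn v hv _ (mem_sliceC_iff.2 ⟨z, rfl⟩)

lemma IsPowerAssoc.CJExtPA {T : V →L[ℝ] V} (hT : IsPowerAssoc T) (J : Oct) : CJExtPA J T :=
  fun n _ _ hv s _ => (hT n).map_rmo hv s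

lemma toSlice_mem_pbResSlice_iff {J : Oct} (hJ : J ∈ unitSphere) {T : V →L[ℝ] V} {z : ℂ} :
    toSlice J z ∈ pbResSlice T J ↔
      IsUnit (sliceHom hJ z - T) ∧ CJExtPA J (Ring.inverse (sliceHom hJ z - T)) := by
  rw [sliceHom_eq]
  exact ⟨fun h => h.2, fun h => ⟨mem_sliceC_iff.2 ⟨z, rfl⟩, h⟩⟩

variable [CompleteSpace V]

lemma ringInverse_mul_one_sub {A : Type*} [NormedRing A] [CompleteSpace A] {u a : A}
    (hu : IsUnit u) (ha : ‖a‖ < 1) :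
    IsUnit (u * (1 - a)) ∧ Ring.inverse (u * (1 - a)) = Ring.inverse (1 - a) * Ring.inverse u := by
  obtain ⟨u, rfl⟩ := hu
  have h : (↑u * (1 - a) : A) = ↑(u * Units.oneSub a ha) := rfl
  refine ⟨h ▸ Units.isUnit _, ?_⟩
  rw [h, Ring.inverse_unit, NormedRing.inverse_one_sub a ha, Ring.inverse_unit, mul_inv_rev]
  rfl

lemma mem_pbResSlice_of_norm_lt {J : Oct} (hJ : J ∈ unitSphere) {T : V →L[ℝ] V}
    (hT : IsPowerAssoc T) {z : ℂ} (hz : ‖T‖ < ‖z‖) : toSlice J z ∈ pbResSlice T J := by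
  have hz0 : z ≠ 0 := norm_pos_iff.1 ((norm_nonneg T).trans_lt hz)
  have hmul : (sliceHom hJ z * sliceHom hJ z⁻¹ : V →L[ℝ] V) = 1 := by
    rw [← map_mul, mul_inv_cancel₀ hz0, map_one]
  have hmul' : (sliceHom hJ z⁻¹ * sliceHom hJ z : V →L[ℝ] V) = 1 := by
    rw [← map_mul, inv_mul_cancel₀ hz0, map_one]
  let u : (V →L[ℝ] V)ˣ := ⟨sliceHom hJ z, sliceHom hJ z⁻¹, hmul, hmul'⟩
  have hfac : sliceHom hJ z - T = (u : V →L[ℝ] V) * (1 - sliceHom hJ z⁻¹ * T) := by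
    rw [mul_sub, mul_one, ← mul_assoc, show (u : V →L[ℝ] V) = sliceHom hJ z from rfl, hmul,
      one_mul]
  have hlt : ‖sliceHom hJ z⁻¹ * T‖ < 1 := by
    refine (norm_mul_le _ _).trans_lt ?_
    calc _ ≤ ‖z⁻¹‖ * ‖T‖ := by gcongr; exact norm_sliceHom_le hJ _
      _ < 1 := by
        rw [norm_inv, inv_mul_lt_iff₀ (norm_pos_iff.2 hz0), mul_one]
        exact hz
  have h := ringInverse_mul_one_sub u.isUnit hlt
  rw [← hfac, Ring.inverse_unit] at h
  refine (toSlice_mem_pbResSlice_iff hJ).2 ⟨h.1, ?_⟩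
  rw [h.2]
  refine CJExtPA_of_mem_sliceAlg hJ (ReSet_subset_powComm hJ (hT.CJExtPA J))
    (Subalgebra.mul_mem _ (ringInverse_one_sub_mem (isClosed_sliceAlg hJ (isClosed_powComm hJ T))
      (Subalgebra.mul_mem _ ?_ ?_) hlt) ?_)
  · exact sliceHom_mem_sliceAlg_powComm hJ T _
  · exact self_mem_sliceAlg_powComm hJ T
  · exact sliceHom_mem_sliceAlg_powComm hJ T _

/-- Near a point `z` of the slice resolvent set, the resolvent exists and lies in the closed
algebra of operators attached to the resolvent at `z`. -/
lemma eventually_isUnit_and_mem_sliceAlg {J : Oct} (hJ : J ∈ unitSphere) {T : V →L[ℝ] V} {z : ℂ}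
    (hz : IsUnit (sliceHom hJ z - T)) :
    ∀ᶠ w in nhds z, IsUnit (sliceHom hJ w - T) ∧ Ring.inverse (sliceHom hJ w - T) ∈
      sliceAlg hJ (powComm hJ (Ring.inverse (sliceHom hJ z - T))) := by
  set S := Ring.inverse (sliceHom hJ z - T) with hS
  have hlim : Filter.Tendsto (fun w : ℂ => ‖S‖ * ‖z - w‖) (nhds z) (nhds 0) := by
    have : Filter.Tendsto (fun w : ℂ => ‖S‖ * ‖z - w‖) (nhds z) (nhds (‖S‖ * ‖z - z‖)) :=
      Continuous.tendsto (by fun_prop) z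
    simpa using this
  filter_upwards [hlim.eventually (gt_mem_nhds one_pos)] with w hw
  have hfac : sliceHom hJ w - T = (sliceHom hJ z - T) * (1 - S * sliceHom hJ (z - w)) := by
    rw [mul_sub, mul_one, ← mul_assoc, Ring.mul_inverse_cancel _ hz, one_mul, map_sub]
    abel
  have hlt : ‖S * sliceHom hJ (z - w)‖ < 1 := by
    refine (norm_mul_le _ _).trans_lt (lt_of_le_of_lt ?_ hw)
    gcongr
    exact norm_sliceHom_le hJ _
  have h := ringInverse_mul_one_sub hz hlt
  rw [← hfac] at h
  refine ⟨h.1, ?_⟩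
  rw [h.2]
  have hmem := self_mem_sliceAlg_powComm hJ S
  exact Subalgebra.mul_mem _ (ringInverse_one_sub_mem
    (isClosed_sliceAlg hJ (isClosed_powComm hJ S))
      (Subalgebra.mul_mem _ hmem (sliceHom_mem_sliceAlg_powComm hJ S _)) hlt) hmem

lemma isOpen_preimage_pbResSlice {J : Oct} (hJ : J ∈ unitSphere) (T : V →L[ℝ] V) :
    IsOpen (toSlice J ⁻¹' pbResSlice T J) := by
  rw [isOpen_iff_mem_nhds]
  intro z hz
  have hz' := (toSlice_mem_pbResSlice_iff hJ).1 hz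
  filter_upwards [eventually_isUnit_and_mem_sliceAlg hJ hz'.1] with w hw
  exact (toSlice_mem_pbResSlice_iff hJ).2
    ⟨hw.1, CJExtPA_of_mem_sliceAlg hJ (ReSet_subset_powComm hJ hz'.2) hw.2⟩

/-- The vector space structure over `ℂ` given by right multiplication by the slice `ℂ_J`. -/
abbrev sliceNormedSpace {J : Oct} (hJ : J ∈ unitSphere) : NormedSpace ℂ V :=
  { Module.compHom V (sliceHom hJ : ℂ →ₐ[ℝ] V →L[ℝ] V).toRingHom with
    norm_smul_le := fun z x => (norm_sliceHom_apply hJ z x).le }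

lemma exists_notMem_pbResSlice [Nontrivial V] {J : Oct} (hJ : J ∈ unitSphere)
    (T : V →L[ℝ] V) : ∃ z, toSlice J z ∉ pbResSlice T J := by
  by_contra! hall
  have hres := fun z => (toSlice_mem_pbResSlice_iff hJ).1 (hall z)
  obtain ⟨v, hv, hv0⟩ := exists_mem_ReSet_ne_zero (V := V)
  let : NormedSpace ℂ V := sliceNormedSpace hJ
  have hsmul : ∀ (z : ℂ) (x : V), z • x = sliceHom hJ z x := fun _ _ => rfl
  set S : ℂ → V →L[ℝ] V := fun z => Ring.inverse (sliceHom hJ z - T) with hS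
  have hcont : Continuous S := by
    rw [continuous_iff_continuousAt]
    intro z
    obtain ⟨u, hu⟩ := (hres z).1
    have h1 : ContinuousAt Ring.inverse (sliceHom hJ z - T) :=
      hu ▸ NormedRing.inverse_continuousAt u
    exact ContinuousAt.comp (f := fun z => sliceHom hJ z - T) h1
      ((continuous_sliceHom hJ).sub continuous_const).continuousAt
  have hright : ∀ z, (sliceHom hJ z - T : V →L[ℝ] V) (S z v) = v := fun z =>
    congrArg (fun A : V →L[ℝ] V => A v) (Ring.mul_inverse_cancel _ (hres z).1)
  have hdiff : Differentiable ℂ fun z => S z v := by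
    intro z
    refine HasDerivAt.differentiableAt (f' := -(S z (S z v))) ?_
    rw [hasDerivAt_iff_tendsto_slope]
    have hlim : Filter.Tendsto (fun w => -(S z (S w v))) (nhdsWithin z {z}ᶜ)
        (nhds (-(S z (S z v)))) :=
      (Continuous.tendsto (by fun_prop) z).mono_left nhdsWithin_le_nhds
    refine hlim.congr' ?_
    filter_upwards [self_mem_nhdsWithin, nhdsWithin_le_nhds
      (eventually_isUnit_and_mem_sliceAlg hJ (hres z).1)] with w hwz hw
    have hmem : S z (S w v) ∈ powComm hJ (S z) ∧ ∀ c, S z (sliceHom hJ c (S w v)) =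
        sliceHom hJ c (S z (S w v)) :=
      self_mem_sliceAlg_powComm hJ (S z) _
        (hw.2 v (ReSet_subset_powComm hJ (hres z).2 hv)).1
    have hid : S w v - S z v = -((w - z) • S z (S w v)) := by
      have hleft : S z ((sliceHom hJ z - T : V →L[ℝ] V) (S w v)) = S w v :=
        congrArg (fun A : V →L[ℝ] V => A (S w v)) (Ring.inverse_mul_cancel _ (hres z).1)
      rw [hsmul, ← hmem.2, ← map_neg, map_sub]
      nth_rewrite 1 [← hleft]
      nth_rewrite 2 [← hright w]
      rw [← map_sub]
      congr 1
      simp only [sub_apply]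
      abel
    rw [slope_def_module, hid, smul_neg, smul_smul, inv_mul_cancel₀ (sub_ne_zero.2 hwz), one_smul]
  have hzero : Filter.Tendsto (fun z => S z v) (Filter.cocompact ℂ) (nhds 0) := by
    have hnorm : Filter.Tendsto (fun z : ℂ => ‖z‖ - ‖T‖) (Filter.cocompact ℂ) Filter.atTop :=
      Filter.tendsto_atTop_add_const_right _ _ tendsto_norm_cocompact_atTop
    refine squeeze_zero_norm' ?_ (hnorm.const_div_atTop ‖v‖)
    filter_upwards [hnorm.eventually_gt_atTop 0] with z hz
    rw [le_div_iff₀ hz, mul_comm, sub_mul, ← norm_sliceHom_apply hJ]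
    calc _ ≤ ‖sliceHom hJ z (S z v)‖ - ‖T (S z v)‖ := by gcongr; exact T.le_opNorm _
      _ ≤ ‖(sliceHom hJ z - T : V →L[ℝ] V) (S z v)‖ := norm_sub_norm_le _ _
      _ = ‖v‖ := by rw [hright]
  have h0 : S 0 v = 0 := hdiff.apply_eq_of_tendsto_cocompact 0 hzero
  have h1 := hright 0
  rw [h0, map_zero] at h1
  exact hv0 h1.symm

end Bimodule

/-- Let `V` be a nonzero Banach `𝕆`-bimodule and `T` a power-associative
bounded right para-linear operator.  Then every `s ∈ 𝕆` with `|s| > ‖T‖` lies in `ρ*(T)`,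
and for every `J ∈ 𝕊` the slice pull-back spectrum `σ*_J(T) = ℂ_J ∖ ρ*_J(T)` is a nonempty
compact subset of `ℂ_J` contained in the closed disk of radius `‖T‖`. -/
theorem statement_9 {V : Type*} [NormedAddCommGroup V] [NormedSpace ℝ V] [CompleteSpace V]
    [Nontrivial V] [OctBimodule V] (T : V →L[ℝ] V) (hT : IsRightPara T)
    (hpa : IsPowerAssoc T) :
    (∀ s : Oct, ‖T‖ < ‖s‖ → s ∈ pbRes T) ∧
    ∀ J ∈ unitSphere,
      IsCompact (sliceC J \ pbResSlice T J) ∧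
      (sliceC J \ pbResSlice T J).Nonempty ∧
      (sliceC J \ pbResSlice T J) ⊆ {s : Oct | ‖s‖ ≤ ‖T‖} := by
  have hlarge : ∀ J ∈ unitSphere, ∀ s ∈ sliceC J, ‖T‖ < ‖s‖ → s ∈ pbResSlice T J := by
    rintro J hJ s hs hlt
    obtain ⟨z, rfl⟩ := mem_sliceC_iff.1 hs
    rw [norm_toSlice hJ] at hlt
    exact mem_pbResSlice_of_norm_lt hJ hpa hlt
  refine ⟨fun s hs => ?_, fun J hJ => ⟨?_, ?_, ?_⟩⟩
  · obtain ⟨J, hJ, hsJ⟩ := exists_mem_sliceC s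
    exact Set.mem_biUnion hJ (hlarge J hJ s hsJ hs)
  · have himage : sliceC J \ pbResSlice T J =
        toSlice J '' (toSlice J ⁻¹' pbResSlice T J)ᶜ := by
      ext s
      constructor
      · rintro ⟨hs, hs'⟩
        obtain ⟨z, rfl⟩ := mem_sliceC_iff.1 hs
        exact ⟨z, hs', rfl⟩
      · rintro ⟨z, hz, rfl⟩
        exact ⟨mem_sliceC_iff.2 ⟨z, rfl⟩, hz⟩
    have hcont : Continuous (toSlice J) :=
      (Complex.continuous_re.smul continuous_const).add
        (Complex.continuous_im.smul continuous_const)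
    rw [himage]
    refine IsCompact.image ((isCompact_closedBall (0 : ℂ) ‖T‖).of_isClosed_subset
      (isOpen_preimage_pbResSlice hJ T).isClosed_compl fun z hz => ?_) hcont
    rw [mem_closedBall_zero_iff]
    by_contra! hlt
    exact hz (mem_pbResSlice_of_norm_lt hJ hpa hlt)
  · obtain ⟨z, hz⟩ := exists_notMem_pbResSlice hJ T
    exact ⟨toSlice J z, mem_sliceC_iff.2 ⟨z, rfl⟩, hz⟩
  · rintro s ⟨hs, hs'⟩
    by_contra! hlt
    exact hs' (hlarge J hJ s hs (not_le.1 hlt))
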